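/- arXiv:1212.2134 — 4 statements merged into one kernel-verified Lean document; each statement's English description precedes it below -/
import Mathlib

section
/- Let S be a set of vertices and let E be an oriented-edge relation on S (loops allowed), and assume the resulting oriented graph is connected (any two vertices are joined by a finite path of edges traversed in either direction). Then the graph is cyclic — that is, every edge from a vertex p to a vertex q lies on an oriented cycle, equivalently there is a finite oriented path of edges from q back to p — if and only if for every partition S = T ∪ T' into two disjoint nonempty subsets there exist t ∈ T and t' ∈ T' with an edge starting at t and ending at t'. -/
/-- A path that starts in `T` and ends outside `T` has a step leaving `T`. -/
theorem Relation.ReflTransGen.exists_step_mem_notMem {α : Type*} {r : α → α → Prop} {a b : α}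
    (h : Relation.ReflTransGen r a b) {T : Set α} (ha : a ∈ T) (hb : b ∉ T) :
    ∃ t ∈ T, ∃ t' ∈ Tᶜ, r t t' := by
  induction h with
  | refl => exact absurd ha hb
  | @tail c d _ hcd ih =>
    by_cases hc : c ∈ T
    · exact ⟨c, hc, d, hb, hcd⟩
    · exact ih hc

/-- An oriented graph (vertex type `V`, oriented-edge relation `E`,
loops allowed) that is connected (any two vertices are joined by a finite path of
edges traversed in either direction) is cyclic — every edge from `p` to `q` lies on
an oriented cycle, equivalently there is an oriented path from `q` back to `p` —
if and only if for every partition of the vertex set into two disjoint nonempty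
subsets `T` and `Tᶜ` there is an edge starting in `T` and ending in `Tᶜ`. -/
theorem cyclic_iff_partition_edge {V : Type*} (E : V → V → Prop)
    (hconn : ∀ a b : V, Relation.ReflTransGen (fun x y => E x y ∨ E y x) a b) :
    (∀ p q : V, E p q → Relation.ReflTransGen E q p) ↔
      (∀ T : Set V, T.Nonempty → Tᶜ.Nonempty →
        ∃ t ∈ T, ∃ t' ∈ Tᶜ, E t t') := by
  constructor
  · rintro hcyc T ⟨a, ha⟩ ⟨b, hb⟩
    have hab : Relation.ReflTransGen E a b := by
      refine Relation.reflTransGen_closed ?_ a b (hconn a b)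
      rintro x y (hxy | hyx)
      · exact .single hxy
      · exact hcyc y x hyx
    exact hab.exists_step_mem_notMem ha hb
  · intro hpart p q _
    by_contra hqp
    obtain ⟨t, ht, t', ht', htt'⟩ :=
      hpart {x | Relation.ReflTransGen E q x} ⟨q, .refl⟩ ⟨p, hqp⟩
    exact ht' (Relation.ReflTransGen.tail ht htt')
end

section
/- Let S be a set of vertices and E an oriented-edge relation on S such that for every partition S = T ∪ T' into two disjoint nonempty subsets there exist t ∈ T and t' ∈ T' with an edge starting at t and ending at t'. Then for any two vertices q, p ∈ S there is an oriented segment (possibly of length zero) starting at q and ending at p; that is, the graph is strongly connected. -/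
/-- If an oriented graph (vertex type `V`, edge relation `E`, loops
allowed) has the property that for every partition of the vertex set into two
disjoint nonempty subsets `T` and `Tᶜ` there is an edge starting in `T` and ending
in `Tᶜ`, then for any two vertices `q`, `p` there is an oriented segment (possibly
of length zero) starting at `q` and ending at `p`: the graph is strongly connected. -/
theorem strongly_connected_of_partition_edge {V : Type*} (E : V → V → Prop)
    (h : ∀ T : Set V, T.Nonempty → Tᶜ.Nonempty → ∃ t ∈ T, ∃ t' ∈ Tᶜ, E t t') :
    ∀ q p : V, Relation.ReflTransGen E q p := by
  intro q p
  by_contra hp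
  obtain ⟨t, ht, t', ht', hE⟩ := h {x | Relation.ReflTransGen E q x} ⟨q, .refl⟩ ⟨p, hp⟩
  exact ht' (Relation.ReflTransGen.tail ht hE)
end

section
/- The weight is invariant under germs of positively oriented analytic diffeomorphisms of the quadrant: let U be a neighborhood of the origin in ℝ² and f = (f₁, f₂) : U → ℝ² real analytic with f(0,0) = (0,0), f₁(0,y) = 0 and f₂(x,0) = 0 for all points of U on the axes, ∂f₁/∂x(0,0) > 0 and ∂f₂/∂y(0,0) > 0, and f mapping U ∩ ℝ²_{>0} into ℝ²_{>0} and U ∩ ℝ²_{≥0} into ℝ²_{≥0}. If c = (c₁, c₂) : [1,∞) → ℝ²_{>0} is a parameterized real analytic curve with c'(t) ≠ 0 for t > 1, lim_{t→∞} c(t) = (0,0), and weight ρ > 0 at the origin, then f ∘ c also has weight ρ at the origin: there exist constants 0 < k₁' < k₂' and t₁ ≥ 1 such that c(t) ∈ U and k₁'·(f₁(c(t)))^ρ < f₂(c(t)) < k₂'·(f₁(c(t)))^ρ for all t > t₁. -/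
open Filter Set

/-- A parameterized real analytic curve `c : [1,∞) → ℝ²_{>0}` with nonvanishing
derivative for `t > 1` and limit `(0,0)` at infinity. -/
def WeightCurve (c : ℝ → ℝ × ℝ) : Prop :=
  AnalyticOnNhd ℝ c (Set.Ici 1) ∧
  (∀ t ∈ Set.Ici (1 : ℝ), 0 < (c t).1 ∧ 0 < (c t).2) ∧
  (∀ t : ℝ, 1 < t → deriv c t ≠ 0) ∧
  Tendsto c atTop (nhds (0, 0))

/-- The curve `c` has weight `ρ` at the origin:
`k₁·c₁(t)^ρ < c₂(t) < k₂·c₁(t)^ρ` for all `t > t₀`. -/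
def CurveHasWeight (c : ℝ → ℝ × ℝ) (ρ : ℝ) : Prop :=
  ∃ k₁ k₂ t₀ : ℝ, 0 < k₁ ∧ k₁ < k₂ ∧ 1 < t₀ ∧
    ∀ t : ℝ, t₀ < t → k₁ * (c t).1 ^ ρ < (c t).2 ∧ (c t).2 < k₂ * (c t).1 ^ ρ

open Topology in
/-- A function strictly differentiable at `0` which vanishes near `0` on the range of `π`, where
`p = π p + s p • v`, is comparable to `s` near `0` as soon as its derivative along `v` is
positive. -/
theorem HasStrictFDerivAt.eventually_two_sided_bound {E : Type*} [NormedAddCommGroup E]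
    [NormedSpace ℝ E] {g : E → ℝ} {g' : E →L[ℝ] ℝ} (hg : HasStrictFDerivAt g g' 0)
    {π : E → E} (hπ : Tendsto π (𝓝 0) (𝓝 0)) {v : E} (hv : ‖v‖ = 1) {s : E → ℝ}
    (hs : ∀ p, p - π p = s p • v) (hzero : ∀ᶠ p in 𝓝 (0 : E), g (π p) = 0)
    (ha : 0 < g' v) :
    ∀ᶠ p in 𝓝 (0 : E), 0 < s p → g' v / 2 * s p ≤ g p ∧ g p ≤ 2 * g' v * s p := by
  have hpair : Tendsto (fun p => (p, π p)) (𝓝 0) (𝓝 ((0 : E), (0 : E))) :=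
    tendsto_id.prodMk_nhds hπ
  filter_upwards [hpair.eventually (hg.isLittleO.def (half_pos ha)), hzero] with p hp h0 hpos
  simp only [h0, hs, map_smul, norm_smul, hv, smul_eq_mul, Real.norm_eq_abs, _root_.abs_of_pos hpos,
    sub_zero, mul_one, abs_le] at hp
  have hmul := mul_pos ha hpos
  constructor <;> linarith [hp.1, hp.2]

/-- The weight is invariant under germs of positively oriented analytic
diffeomorphisms of the quadrant.  Let `f = (f₁,f₂)` be analytic on a neighborhood `U`
of the origin of `ℝ²`, with `f(0,0) = (0,0)`, `f₁(0,y) = 0` and `f₂(x,0) = 0` on the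
axes, positive diagonal derivatives `∂f₁/∂x(0,0) > 0` and `∂f₂/∂y(0,0) > 0`, mapping
`U ∩ ℝ²_{>0}` into `ℝ²_{>0}` and `U ∩ ℝ²_{≥0}` into `ℝ²_{≥0}`.  If `c` is a
parameterized real analytic curve of weight `ρ > 0` at the origin, then `f ∘ c` also
has weight `ρ` at the origin (eventually `c(t) ∈ U` and the weight estimate holds for
`f ∘ c`). -/
theorem weight_invariant_under_diffeo
    (U : Set (ℝ × ℝ)) (hU : U ∈ nhds ((0 : ℝ), (0 : ℝ)))
    (f : ℝ × ℝ → ℝ × ℝ) (hf : AnalyticOnNhd ℝ f U)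
    (hf0 : f (0, 0) = (0, 0))
    (haxis1 : ∀ p ∈ U, p.1 = 0 → (f p).1 = 0)
    (haxis2 : ∀ p ∈ U, p.2 = 0 → (f p).2 = 0)
    (hder1 : 0 < (fderiv ℝ f ((0 : ℝ), (0 : ℝ)) (1, 0)).1)
    (hder2 : 0 < (fderiv ℝ f ((0 : ℝ), (0 : ℝ)) (0, 1)).2)
    (hopen : ∀ p ∈ U, 0 < p.1 → 0 < p.2 → 0 < (f p).1 ∧ 0 < (f p).2)
    (hclosed : ∀ p ∈ U, 0 ≤ p.1 → 0 ≤ p.2 → 0 ≤ (f p).1 ∧ 0 ≤ (f p).2)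
    (c : ℝ → ℝ × ℝ) (ρ : ℝ) (hρ : 0 < ρ)
    (hc : WeightCurve c) (hw : CurveHasWeight c ρ) :
    ∃ k₁' k₂' t₁ : ℝ, 0 < k₁' ∧ k₁' < k₂' ∧ 1 ≤ t₁ ∧
      ∀ t : ℝ, t₁ < t → c t ∈ U ∧
        k₁' * (f (c t)).1 ^ ρ < (f (c t)).2 ∧
        (f (c t)).2 < k₂' * (f (c t)).1 ^ ρ := by
  obtain ⟨-, hpos, -, hlim⟩ := hc
  obtain ⟨k₁, k₂, t₀, hk₁, hk, ht₀, hkc⟩ := hw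
  have hU' : U ∈ nhds (0 : ℝ × ℝ) := hU
  have hstrict : HasStrictFDerivAt f (fderiv ℝ f 0) 0 :=
    (hf 0 (mem_of_mem_nhds hU')).hasStrictFDerivAt
  have hπ₁ : Tendsto (fun p : ℝ × ℝ => ((0 : ℝ), p.2)) (nhds 0) (nhds 0) :=
    Continuous.tendsto' (by fun_prop) _ _ rfl
  have hπ₂ : Tendsto (fun p : ℝ × ℝ => (p.1, (0 : ℝ))) (nhds 0) (nhds 0) :=
    Continuous.tendsto' (by fun_prop) _ _ rfl
  have hbound₁ := hstrict.fst.eventually_two_sided_bound hπ₁ (v := ((1 : ℝ), (0 : ℝ)))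
    (by simp [Prod.norm_def]) (s := Prod.fst) (fun p => by ext <;> simp)
    ((hπ₁.eventually hU').mono fun p hp => haxis1 _ hp rfl) hder1
  have hbound₂ := hstrict.snd.eventually_two_sided_bound hπ₂ (v := ((0 : ℝ), (1 : ℝ)))
    (by simp [Prod.norm_def]) (s := Prod.snd) (fun p => by ext <;> simp)
    ((hπ₂.eventually hU').mono fun p hp => haxis2 _ hp rfl) hder2
  obtain ⟨T, hT⟩ := eventually_atTop.1
    ((hlim.eventually hU).and ((hlim.eventually hbound₁).and (hlim.eventually hbound₂)))
  set a : ℝ := (fderiv ℝ f ((0 : ℝ), (0 : ℝ)) (1, 0)).1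
  set b : ℝ := (fderiv ℝ f ((0 : ℝ), (0 : ℝ)) (0, 1)).2
  change ∀ t ≥ T, c t ∈ U ∧
    (0 < (c t).1 → a / 2 * (c t).1 ≤ (f (c t)).1 ∧ (f (c t)).1 ≤ 2 * a * (c t).1) ∧
    (0 < (c t).2 → b / 2 * (c t).2 ≤ (f (c t)).2 ∧ (f (c t)).2 ≤ 2 * b * (c t).2) at hT
  have hk₂ : 0 < k₂ := hk₁.trans hk
  have hl : 0 < b / 2 * k₁ * (1 / (2 * a)) ^ ρ := by positivity
  have hu : 0 < 2 * b * k₂ * (2 / a) ^ ρ := by positivity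
  refine ⟨b / 2 * k₁ * (1 / (2 * a)) ^ ρ,
    b / 2 * k₁ * (1 / (2 * a)) ^ ρ + 2 * b * k₂ * (2 / a) ^ ρ, max t₀ T, hl,
    lt_add_of_pos_right _ hu, ht₀.le.trans (le_max_left _ _), fun t ht => ?_⟩
  obtain ⟨ht₀', htT⟩ := max_lt_iff.1 ht
  obtain ⟨hx, hy⟩ := hpos t (ht₀.trans ht₀').le
  obtain ⟨hcU, h₁, h₂⟩ := hT t htT.le
  obtain ⟨hlow₁, hup₁⟩ := h₁ hx
  obtain ⟨hlow₂, hup₂⟩ := h₂ hy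
  obtain ⟨hlow, hup⟩ := hkc t ht₀'
  have hfx : 0 < (f (c t)).1 := (hopen _ hcU hx hy).1
  have hpow_le : (1 / (2 * a)) ^ ρ * (f (c t)).1 ^ ρ ≤ (c t).1 ^ ρ := by
    rw [← Real.mul_rpow (by positivity) hfx.le]
    refine Real.rpow_le_rpow (by positivity) ?_ hρ.le
    rw [one_div_mul_eq_div, div_le_iff₀' (by positivity)]
    exact hup₁
  have hle_pow : (c t).1 ^ ρ ≤ (2 / a) ^ ρ * (f (c t)).1 ^ ρ := by
    rw [← Real.mul_rpow (by positivity) hfx.le]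
    refine Real.rpow_le_rpow hx.le ?_ hρ.le
    rw [div_mul_eq_mul_div, le_div_iff₀ hder1]
    linarith
  refine ⟨hcU, ?_, ?_⟩
  · calc b / 2 * k₁ * (1 / (2 * a)) ^ ρ * (f (c t)).1 ^ ρ
        = b / 2 * (k₁ * ((1 / (2 * a)) ^ ρ * (f (c t)).1 ^ ρ)) := by ring
      _ ≤ b / 2 * (k₁ * (c t).1 ^ ρ) := by gcongr
      _ < b / 2 * (c t).2 := by gcongr
      _ ≤ (f (c t)).2 := hlow₂
  · calc (f (c t)).2 ≤ 2 * b * (c t).2 := hup₂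
      _ < 2 * b * (k₂ * (c t).1 ^ ρ) := by gcongr
      _ ≤ 2 * b * (k₂ * ((2 / a) ^ ρ * (f (c t)).1 ^ ρ)) := by gcongr
      _ = 2 * b * k₂ * (2 / a) ^ ρ * (f (c t)).1 ^ ρ := by ring
      _ ≤ (b / 2 * k₁ * (1 / (2 * a)) ^ ρ + 2 * b * k₂ * (2 / a) ^ ρ) * (f (c t)).1 ^ ρ := by
        gcongr
        exact le_add_of_nonneg_left hl.le
end

section
/- Weight transition through a three-dimensional saddle, first case: with the vector field ξ, the cylinder B, the map φ_x, the fence Φ and the saturation as in the context, let C' ⊆ {(u,v) : u > 0, v > 0, u² + v² ≤ 1} be a subset of weight ρ' at the origin with ρ' > μ/λ, and let S' be the saturation of φ_x(C') by the ξ-flow in B. Then Φ⁻¹(S') is contained in ℝ²_{>0} and has weight 1/(λρ' − μ) at the origin. -/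
open Filter Set

/-- A subset `C ⊆ ℝ²_{>0}` has weight `ρ` if it is the image of a parameterized
real analytic curve of weight `ρ`. -/
def SetHasWeight (C : Set (ℝ × ℝ)) (ρ : ℝ) : Prop :=
  ∃ c : ℝ → ℝ × ℝ, WeightCurve c ∧ CurveHasWeight c ρ ∧ C = c '' Set.Ici 1

/-- The cylinder `B = {0 ≤ x ≤ 1, 0 ≤ y, 0 ≤ z, y² + z² ≤ 1}` in `ℝ³`. -/
def Bcyl : Set (ℝ × ℝ × ℝ) :=
  {p | 0 ≤ p.1 ∧ p.1 ≤ 1 ∧ 0 ≤ p.2.1 ∧ 0 ≤ p.2.2 ∧ p.2.1 ^ 2 + p.2.2 ^ 2 ≤ 1}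

/-- The saturation of `A` by the `ξ`-flow in `B`: points lying on an integral curve
of `ξ` contained in `B` that starts or ends in `A`. -/
def Saturation (ξ : ℝ × ℝ × ℝ → ℝ × ℝ × ℝ) (A : Set (ℝ × ℝ × ℝ)) : Set (ℝ × ℝ × ℝ) :=
  {p | ∃ s₀ s₁ : ℝ, s₀ ≤ s₁ ∧ ∃ γ : ℝ → ℝ × ℝ × ℝ,
    (∀ τ ∈ Set.Icc s₀ s₁, γ τ ∈ Bcyl) ∧
    (∀ τ ∈ Set.Icc s₀ s₁, HasDerivAt γ (ξ (γ τ)) τ) ∧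
    (∃ s ∈ Set.Icc s₀ s₁, γ s = p) ∧
    (γ s₀ ∈ A ∨ γ s₁ ∈ A)}

/-- The inclusion `φ_x(u,v) = (1,u,v)`. -/
def phiX (q : ℝ × ℝ) : ℝ × ℝ × ℝ := (1, q.1, q.2)

/-- The fence `Φ(u,v) = (v, cos(πu/2), sin(πu/2))`. -/
noncomputable def fencePhi (q : ℝ × ℝ) : ℝ × ℝ × ℝ :=
  (q.2, Real.cos (Real.pi * q.1 / 2), Real.sin (Real.pi * q.1 / 2))

/-- The fence `Φ̄(u,v) = (v, sin(πu/2), cos(πu/2))`. -/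
noncomputable def fencePhiBar (q : ℝ × ℝ) : ℝ × ℝ × ℝ :=
  (q.2, Real.sin (Real.pi * q.1 / 2), Real.cos (Real.pi * q.1 / 2))

/-- The domain `[0,1] × [0,1]` of the fences. -/
def fenceSquare : Set (ℝ × ℝ) := Set.Icc (0 : ℝ) 1 ×ˢ Set.Icc (0 : ℝ) 1

open scoped ContDiff Topology NNReal

section Nemytskii

variable {K E G : Type*} [TopologicalSpace K] [CompactSpace K]
  [NormedAddCommGroup E] [NormedSpace ℝ E] [NormedAddCommGroup G] [NormedSpace ℝ G]

/-- A continuous multilinear map acts pointwise on tuples of continuous functions. -/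
noncomputable def ContinuousMultilinearMap.pointwise {n : ℕ}
    (m : ContinuousMultilinearMap ℝ (fun _ : Fin n => E) G) :
    ContinuousMultilinearMap ℝ (fun _ : Fin n => C(K, E)) C(K, G) :=
  MultilinearMap.mkContinuous
    { toFun := fun h => ⟨fun s => m fun i => h i s, by fun_prop⟩
      map_update_add' := by
        intro _ h i f g
        ext s
        have key : ∀ e : C(K, E), (fun j => (Function.update h i e) j s) =
            Function.update (fun j => h j s) i (e s) := by
          intro e
          funext j
          rcases eq_or_ne j i with rfl | hj <;> simp [*]
        simp [key]
      map_update_smul' := by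
        intro _ h i c f
        ext s
        have key : ∀ e : C(K, E), (fun j => (Function.update h i e) j s) =
            Function.update (fun j => h j s) i (e s) := by
          intro e
          funext j
          rcases eq_or_ne j i with rfl | hj <;> simp [*]
        simp [key] }
    ‖m‖ (by
      intro h
      refine (ContinuousMap.norm_le _ (by positivity)).2 fun s => ?_
      refine (m.le_opNorm _).trans ?_
      gcongr with i
      exact (h i).norm_coe_le_norm s)

theorem ContinuousMultilinearMap.norm_pointwise_le {n : ℕ}
    (m : ContinuousMultilinearMap ℝ (fun _ : Fin n => E) G) :
    ‖(m.pointwise : ContinuousMultilinearMap ℝ (fun _ : Fin n => C(K, E)) C(K, G))‖ ≤ ‖m‖ :=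
  MultilinearMap.mkContinuous_norm_le _ (norm_nonneg _) _

/-- Superposition with an analytic map is analytic at constant functions. -/
theorem AnalyticAt.comp_continuousMap_const [CompleteSpace G] {F : C(E, G)} {p : E}
    (hF : AnalyticAt ℝ F p) :
    AnalyticAt ℝ (fun γ : C(K, E) => F.comp γ) (ContinuousMap.const K p) := by
  obtain ⟨P, r, hP⟩ := hF
  refine ⟨fun n => (P n).pointwise, r, ?_, hP.r_pos, ?_⟩
  · refine hP.r_le.trans ?_
    refine ENNReal.le_of_forall_nnreal_lt fun r' hr' => ?_
    obtain ⟨C, -, hC⟩ := P.norm_mul_pow_le_of_lt_radius hr'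
    refine FormalMultilinearSeries.le_radius_of_bound _ C fun n => ?_
    exact (mul_le_mul_of_nonneg_right (P n).norm_pointwise_le (by positivity)).trans (hC n)
  · intro h hh
    have hr : (‖h‖₊ : ENNReal) < P.radius := by
      refine lt_of_lt_of_le ?_ hP.r_le
      simpa [Metric.mem_eball, edist_zero_right, enorm_eq_nnnorm] using hh
    have hsum : Summable fun n =>
        ((P n).pointwise : ContinuousMultilinearMap ℝ (fun _ : Fin n => C(K, E)) C(K, G))
          fun _ => h := by
      refine Summable.of_norm_bounded (P.summable_norm_mul_pow hr) fun n => ?_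
      refine (ContinuousMultilinearMap.le_opNorm _ _).trans ?_
      simp only [Finset.prod_const, Finset.card_univ, Fintype.card_fin, coe_nnnorm]
      exact mul_le_mul_of_nonneg_right (P n).norm_pointwise_le (by positivity)
    suffices hval : F.comp (ContinuousMap.const K p + h) =
        ∑' n, ((P n).pointwise : ContinuousMultilinearMap ℝ (fun _ : Fin n => C(K, E)) C(K, G))
          fun _ => h by
      simpa only [hval] using hsum.hasSum
    ext s
    have h1 := (ContinuousMap.evalCLM ℝ s : C(K, G) →L[ℝ] G).hasSum hsum.hasSum
    have h2 := hP.hasSum (y := h s) (by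
      simp only [Metric.mem_eball, edist_zero_right, enorm_eq_nnnorm] at hh ⊢
      refine lt_of_le_of_lt ?_ hh
      exact_mod_cast h.norm_coe_le_norm s)
    exact h2.unique h1

end Nemytskii

section Flow

variable {E : Type*} [NormedAddCommGroup E] [NormedSpace ℝ E]

/-- `Fl` is a global flow of the vector field `F`. -/
structure IsGlobalFlow (F : E → E) (Fl : ℝ → E → E) : Prop where
  map_zero : ∀ x, Fl 0 x = x
  hasDerivAt : ∀ x s, HasDerivAt (fun σ => Fl σ x) (F (Fl s x)) s

/-- A bounded Lipschitz vector field has a global flow. -/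
theorem exists_isGlobalFlow [CompleteSpace E] {F : E → E} {K L : ℝ≥0} (hF : LipschitzWith K F)
    (hL : ∀ x, ‖F x‖ ≤ L) : ∃ Fl, IsGlobalFlow F Fl := by
  have key : ∀ (x : E) (n : ℕ), ∃ α : ℝ → E, α 0 = x ∧
      ∀ t ∈ Ioo (-(n + 1) : ℝ) (n + 1), HasDerivAt α (F (α t)) t := by
    intro x n
    have h0 : (0 : ℝ) ∈ Icc (-(n + 1) : ℝ) (n + 1) := by
      constructor <;> linarith [n.cast_nonneg (α := ℝ)]
    have hPL : IsPicardLindelof (fun _ => F) (⟨0, h0⟩ : Icc (-(n + 1) : ℝ) (n + 1)) x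
        (L * (n + 1)) 0 L K :=
      { lipschitzOnWith := fun _ _ => hF.lipschitzOnWith
        continuousOn := fun _ _ => continuousOn_const
        norm_le := fun _ _ y _ => hL y
        mul_max_le := by simp }
    obtain ⟨α, hα0, hα⟩ := hPL.exists_eq_forall_mem_Icc_hasDerivWithinAt₀
    exact ⟨α, hα0, fun t ht => (hα t ⟨ht.1.le, ht.2.le⟩).hasDerivAt (Icc_mem_nhds ht.1 ht.2)⟩
  choose α hα0 hα using key
  have agree : ∀ x (m n : ℕ), m ≤ n → EqOn (α x m) (α x n) (Ioo (-(m + 1) : ℝ) (m + 1)) := by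
    intro x m n hmn
    have hmn' : (m : ℝ) ≤ n := by exact_mod_cast hmn
    refine ODE_solution_unique_of_mem_Ioo (v := fun _ => F) (s := fun _ => univ) (t₀ := 0)
      (fun _ _ => hF.lipschitzOnWith) ?_ (fun t ht => ⟨hα x m t ht, mem_univ _⟩)
      (fun t ht => ⟨hα x n t ⟨?_, ?_⟩, mem_univ _⟩) ((hα0 x m).trans (hα0 x n).symm)
    · constructor <;> linarith [m.cast_nonneg (α := ℝ)]
    · linarith [ht.1]
    · linarith [ht.2]
  refine ⟨fun s x => α x ⌈|s|⌉₊ s, fun x => by simp [hα0], fun x s => ?_⟩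
  have hs : |s| < (⌈|s|⌉₊ : ℝ) + 1 := (Nat.le_ceil _).trans_lt (by linarith)
  have hmem : ∀ {σ : ℝ} {n : ℕ}, |σ| < (n : ℝ) + 1 → σ ∈ Ioo (-(n + 1) : ℝ) (n + 1) :=
    fun h => abs_lt.1 h
  refine (hα x ⌈|s|⌉₊ s (hmem hs)).congr_of_eventuallyEq ?_
  filter_upwards [(continuous_abs.tendsto s).eventually (gt_mem_nhds hs)] with σ hσ
  have hσ' : |σ| < (⌈|σ|⌉₊ : ℝ) + 1 := (Nat.le_ceil _).trans_lt (by linarith)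
  rcases le_total ⌈|σ|⌉₊ ⌈|s|⌉₊ with h | h
  · exact agree x _ _ h (hmem hσ')
  · exact (agree x _ _ h (hmem hσ)).symm

/-- Integration from `0`, as a continuous linear operator on `C([0,1], E)`. -/
noncomputable def volterraCLM (E : Type*) [NormedAddCommGroup E] [NormedSpace ℝ E] :
    C(unitInterval, E) →L[ℝ] C(unitInterval, E) :=
  LinearMap.mkContinuous
    { toFun := fun γ => ⟨fun s => ∫ σ in (0 : ℝ)..s, IccExtend zero_le_one γ σ,
        (intervalIntegral.continuous_primitive
          (fun _ _ => γ.continuous.Icc_extend'.intervalIntegrable _ _) 0).comp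
          continuous_subtype_val⟩
      map_add' := fun γ δ => by
        ext s
        exact intervalIntegral.integral_add (γ.continuous.Icc_extend'.intervalIntegrable _ _)
          (δ.continuous.Icc_extend'.intervalIntegrable _ _)
      map_smul' := fun c γ => by
        ext s
        exact intervalIntegral.integral_smul c _ }
    1 (by
      intro γ
      refine (ContinuousMap.norm_le _ (by positivity)).2 fun s => ?_
      refine (intervalIntegral.norm_integral_le_of_norm_le_const
        (fun σ _ => γ.norm_coe_le_norm (projIcc 0 1 zero_le_one σ))).trans ?_
      rw [sub_zero, abs_of_nonneg s.2.1, one_mul]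
      exact mul_le_of_le_one_right (norm_nonneg _) s.2.2)

namespace IsGlobalFlow

variable {F : E → E} {Fl : ℝ → E → E} {K : ℝ≥0}

theorem map_add (h : IsGlobalFlow F Fl) (hF : LipschitzWith K F) (s σ : ℝ) (x : E) :
    Fl (s + σ) x = Fl s (Fl σ x) := by
  have := ODE_solution_unique_univ (v := fun _ => F) (s := fun _ => univ) (t₀ := 0) (K := K)
    (f := fun s => Fl (s + σ) x) (g := fun s => Fl s (Fl σ x)) (fun _ => hF.lipschitzOnWith)
    (fun t => ⟨(h.hasDerivAt x (t + σ)).comp_add_const t σ, mem_univ _⟩)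
    (fun t => ⟨h.hasDerivAt _ t, mem_univ _⟩) (by simp [h.map_zero])
  exact congrFun this s

variable [CompleteSpace E]

/-- A curve solving the rescaled Picard equation is a rescaled flow line. -/
theorem eq_of_picard (h : IsGlobalFlow F Fl) (hF : LipschitzWith K F) {τ : ℝ} {x : E}
    {γ : C(unitInterval, E)}
    (hγ : γ = ContinuousMap.const unitInterval x +
      τ • volterraCLM E ((⟨F, hF.continuous⟩ : C(E, E)).comp γ)) :
    Fl τ x = γ 1 := by
  set g : ℝ → E := IccExtend zero_le_one ((⟨F, hF.continuous⟩ : C(E, E)).comp γ) with hg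
  have hgc : Continuous g := ContinuousMap.continuous _ |>.Icc_extend'
  set Y : ℝ → E := fun s => x + τ • ∫ σ in (0 : ℝ)..s, g σ with hY
  have hYγ : ∀ s : unitInterval, γ s = Y s := by
    intro s
    conv_lhs => rw [hγ]
    rfl
  have hYd : ∀ s, HasDerivAt Y (τ • g s) s := fun s =>
    ((hgc.integral_hasStrictDerivAt 0 s).hasDerivAt.const_smul τ).const_add x
  have hgY : ∀ s ∈ Icc (0 : ℝ) 1, g s = F (Y s) := by
    intro s hs
    rw [hg, IccExtend_of_mem _ _ hs, ← hYγ ⟨s, hs⟩]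
    rfl
  have hFlY : EqOn (fun s => Fl (τ * s) x) Y (Icc 0 1) := by
    have hd : ∀ s : ℝ, HasDerivAt (fun s => Fl (τ * s) x) (τ • F (Fl (τ * s) x)) s := fun s => by
      have h1 : HasDerivAt (fun s : ℝ => τ * s) τ s := by
        simpa using (hasDerivAt_id s).const_mul τ
      exact (h.hasDerivAt x (τ * s)).scomp s h1
    refine ODE_solution_unique (v := fun _ y => τ • F y) (K := ‖τ‖₊ * K)
      (fun _ => (lipschitzWith_smul τ).comp hF) (fun s _ => (hd s).continuousAt.continuousWithinAt)
      (fun s _ => (hd s).hasDerivWithinAt)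
      (fun s _ => (hYd s).continuousAt.continuousWithinAt)
      (fun s hs => ?_) (by simp [hY, h.map_zero])
    rw [← hgY s ⟨hs.1, hs.2.le⟩]
    exact (hYd s).hasDerivWithinAt
  have := hFlY (right_mem_Icc.2 zero_le_one)
  simp only [mul_one] at this
  rw [this, hYγ 1]
  rfl

/-- The flow of a Lipschitz vector field is jointly analytic at time `0` near each point where the
field is analytic. -/
theorem analyticAt_zero (h : IsGlobalFlow F Fl) (hF : LipschitzWith K F) {p : E}
    (hp : AnalyticAt ℝ F p) : AnalyticAt ℝ (fun q : ℝ × E => Fl q.1 q.2) (0, p) := by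
  set N : C(unitInterval, E) → C(unitInterval, E) :=
    fun γ => (⟨F, hF.continuous⟩ : C(E, E)).comp γ with hN
  set Ψ : (ℝ × E) × C(unitInterval, E) → C(unitInterval, E) := fun w =>
    w.2 - ContinuousLinearMap.const ℝ unitInterval w.1.2 - w.1.1 • volterraCLM E (N w.2) with hΨ
  set u : (ℝ × E) × C(unitInterval, E) := ((0, p), ContinuousMap.const unitInterval p) with hu
  have hNa : AnalyticAt ℝ N u.2 :=
    AnalyticAt.comp_continuousMap_const (F := ⟨F, hF.continuous⟩) hp
  have hΨa : AnalyticAt ℝ Ψ u := by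
    refine (analyticAt_snd.sub ?_).sub ?_
    · exact ((ContinuousLinearMap.const ℝ unitInterval :
        E →L[ℝ] C(unitInterval, E)).analyticAt _).comp (analyticAt_snd.comp analyticAt_fst)
    · exact (analyticAt_fst.comp analyticAt_fst).smul
        (((volterraCLM E).analyticAt _).comp (hNa.comp analyticAt_snd))
  have hΨc : ContDiffAt ℝ ω Ψ u := hΨa.contDiffAt
  have hinv : fderiv ℝ Ψ u ∘L .inr ℝ (ℝ × E) C(unitInterval, E) = .id ℝ _ := by
    have h1 : HasFDerivAt (fun γ : C(unitInterval, E) => ((0, p), γ))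
        (.inr ℝ (ℝ × E) C(unitInterval, E)) (ContinuousMap.const unitInterval p) := by
      exact hasFDerivAt_prodMk_right _ _
    have h2 := HasFDerivAt.comp (g := Ψ) (ContinuousMap.const unitInterval p)
      hΨa.differentiableAt.hasFDerivAt h1
    have h3 : (Ψ ∘ fun γ : C(unitInterval, E) => ((0, p), γ)) =
        fun γ => γ - ContinuousMap.const unitInterval p := by
      funext γ
      ext s
      simp [hΨ]
    rw [h3] at h2
    exact h2.unique ((hasFDerivAt_id _).sub_const _)
  have hinv' : (fderiv ℝ Ψ u ∘L .inr ℝ (ℝ × E) C(unitInterval, E)).IsInvertible := by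
    rw [hinv]
    exact ContinuousLinearMap.isInvertible_equiv (f := ContinuousLinearEquiv.refl ℝ _)
  have hω : (ω : WithTop ℕ∞) ≠ 0 := by simp
  set ψ := hΨc.implicitFunction hω hinv'
  have hψ : AnalyticAt ℝ ψ (0, p) := (hΨc.contDiffAt_implicitFunction hω hinv').analyticAt
  have hev : ∀ᶠ q in 𝓝 ((0, p) : ℝ × E), Ψ (q, ψ q) = Ψ u :=
    hΨc.eventually_apply_implicitFunction hω hinv'
  have hΨu : Ψ u = 0 := by
    ext s
    simp [hΨ, hu]
  refine AnalyticAt.congr (((ContinuousMap.evalCLM ℝ (1 : unitInterval) :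
    C(unitInterval, E) →L[ℝ] E).analyticAt _).comp hψ) ?_
  filter_upwards [hev] with q hq
  rw [hΨu] at hq
  have hq : ψ q - ContinuousMap.const unitInterval q.2 - q.1 • volterraCLM E (N (ψ q)) = 0 := hq
  rw [sub_sub, sub_eq_zero] at hq
  exact (h.eq_of_picard hF hq).symm

/-- The flow of a Lipschitz vector field is jointly analytic along trajectories contained in the
domain of analyticity of the field. -/
theorem analyticAt_uncurry (h : IsGlobalFlow F Fl) (hF : LipschitzWith K F) {S : ℝ} {x : E}
    (hS : ∀ s ∈ uIcc 0 S, AnalyticAt ℝ F (Fl s x)) :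
    AnalyticAt ℝ (fun q : ℝ × E => Fl q.1 q.2) (S, x) := by
  have step : ∀ y y' : ℝ, AnalyticAt ℝ (fun q : ℝ × E => Fl q.1 q.2) (y' - y, Fl y x) →
      AnalyticAt ℝ (fun q : ℝ × E => Fl q.1 q.2) (y, x) →
      AnalyticAt ℝ (fun q : ℝ × E => Fl q.1 q.2) (y', x) := by
    intro y y' h1 h2
    have h3 : AnalyticAt ℝ (fun q : ℝ × E => Fl y q.2) (y', x) :=
      AnalyticAt.fun_comp (g := fun q : ℝ × E => Fl q.1 q.2) (f := fun q : ℝ × E => (y, q.2)) h2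
        (analyticAt_const.prod analyticAt_snd)
    have h4 : AnalyticAt ℝ (fun q : ℝ × E => Fl (q.1 - y) (Fl y q.2)) (y', x) :=
      AnalyticAt.fun_comp (g := fun q : ℝ × E => Fl q.1 q.2)
        (f := fun q : ℝ × E => (q.1 - y, Fl y q.2)) h1
        ((analyticAt_fst.sub analyticAt_const).prod h3)
    refine h4.congr (Eventually.of_forall fun q => ?_)
    simp only
    rw [← h.map_add hF, sub_add_cancel]
  have local_const : ∀ s ∈ uIcc 0 S, ∀ᶠ y in 𝓝[uIcc 0 S] s,
      (AnalyticAt ℝ (fun q : ℝ × E => Fl q.1 q.2) (s, x) ↔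
        AnalyticAt ℝ (fun q : ℝ × E => Fl q.1 q.2) (y, x)) := by
    intro s hs
    have hev := (h.analyticAt_zero hF (hS s hs)).eventually_analyticAt
    have hcont : ContinuousAt (fun y => Fl y x) s := (h.hasDerivAt x s).continuousAt
    have t1 : Tendsto (fun y => (y - s, Fl s x)) (𝓝 s) (𝓝 ((0 : ℝ), Fl s x)) := by
      have : ContinuousAt (fun y => (y - s, Fl s x)) s := by fun_prop
      simpa [ContinuousAt] using this
    have t2 : Tendsto (fun y => (s - y, Fl y x)) (𝓝 s) (𝓝 ((0 : ℝ), Fl s x)) := by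
      have : ContinuousAt (fun y => (s - y, Fl y x)) s := by fun_prop
      simpa [ContinuousAt] using this
    filter_upwards [nhdsWithin_le_nhds (t1.eventually hev),
      nhdsWithin_le_nhds (t2.eventually hev)] with y h1 h2
    exact ⟨step s y h1, step y s h2⟩
  have := isPreconnected_uIcc.induction₂ (s := uIcc 0 S)
    (fun s y => AnalyticAt ℝ (fun q : ℝ × E => Fl q.1 q.2) (s, x) ↔
        AnalyticAt ℝ (fun q : ℝ × E => Fl q.1 q.2) (y, x)) local_const
    (fun _ _ _ _ _ _ => Iff.trans) (fun _ _ _ _ => Iff.symm) left_mem_uIcc right_mem_uIcc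
  refine this.1 (h.analyticAt_zero hF ?_)
  simpa [h.map_zero] using hS 0 left_mem_uIcc

end IsGlobalFlow

end Flow

section Auxiliary

/-- A smooth cutoff function equal to `1` near a compact set. -/
theorem exists_smooth_cutoff {E : Type*} [NormedAddCommGroup E] [NormedSpace ℝ E]
    [FiniteDimensional ℝ E] {U K : Set E} (hU : IsOpen U) (hK : IsCompact K) (hKU : K ⊆ U) :
    ∃ χ : E → ℝ, ContDiff ℝ ∞ χ ∧ (∀ x, χ x ∈ Icc (0 : ℝ) 1) ∧ (∀ x ∈ K, ∀ᶠ y in 𝓝 x, χ y = 1) ∧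
      HasCompactSupport χ ∧ tsupport χ ⊆ U := by
  have : ProperSpace E := FiniteDimensional.proper ℝ E
  obtain ⟨L, hL, hKL, hLU⟩ := exists_compact_between hK hU hKU
  obtain ⟨f, h1, h0, hf⟩ := exists_contMDiffMap_one_nhds_of_subset_interior (n := ⊤)
    (modelWithCornersSelf ℝ E) hK.isClosed hKL
  have hsupp : tsupport f ⊆ L :=
    closure_minimal (fun x hx => by_contra fun hxL => hx (h0 x hxL)) hL.isClosed
  refine ⟨f, f.contMDiff.contDiff, hf, fun x hx => ?_, ?_, hsupp.trans hLU⟩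
  · exact h1.filter_mono (nhds_le_nhdsSet hx)
  · exact HasCompactSupport.intro hL h0

/-- Multiplying by a cutoff function supported in an open set preserves smoothness. -/
theorem ContDiffOn.cutoff_smul {E G : Type*} [NormedAddCommGroup E] [NormedSpace ℝ E]
    [NormedAddCommGroup G] [NormedSpace ℝ G] {U : Set E} (hU : IsOpen U) {χ : E → ℝ}
    (hχ : ContDiff ℝ ∞ χ) (hχU : tsupport χ ⊆ U) {g : E → G} (hg : ContDiffOn ℝ ∞ g U) :
    ContDiff ℝ ∞ fun x => χ x • g x := by
  refine contDiff_iff_contDiffAt.2 fun x => ?_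
  by_cases hx : x ∈ tsupport χ
  · exact hχ.contDiffAt.smul (hg.contDiffAt (hU.mem_nhds (hχU hx)))
  · refine (contDiffAt_const (c := (0 : G))).congr_of_eventuallyEq ?_
    filter_upwards [(isClosed_tsupport χ).isOpen_compl.mem_nhds hx] with y hy
    rw [image_eq_zero_of_notMem_tsupport hy, zero_smul]

/-- A solution of a scalar linear equation which starts positive stays positive. -/
theorem pos_of_hasDerivAt_mul {k w : ℝ → ℝ} (hk : Continuous k)
    (hw : ∀ s, HasDerivAt w (k s * w s) s) (h0 : 0 < w 0) (s : ℝ) : 0 < w s := by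
  set P : ℝ → ℝ := fun s => ∫ τ in (0 : ℝ)..s, k τ
  have hP : ∀ s, HasDerivAt P (k s) s := fun s => (hk.integral_hasStrictDerivAt 0 s).hasDerivAt
  have hd : ∀ s, HasDerivAt (fun s => w s * Real.exp (-P s)) 0 s := fun s => by
    refine ((hw s).mul (hP s).fun_neg.exp).congr_deriv ?_
    ring
  have hc := is_const_of_deriv_eq_zero (fun s => (hd s).differentiableAt) (fun s => (hd s).deriv)
    s 0
  simp only [P, intervalIntegral.integral_same, neg_zero, Real.exp_zero, mul_one] at hc
  exact (pos_iff_pos_of_mul_pos (hc ▸ h0)).2 (Real.exp_pos _)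

/-- Reparameterization: an integral curve of a positive multiple of `v` can be rescaled into an
integral curve of `v`. -/
theorem exists_reparam {E : Type*} [NormedAddCommGroup E] [NormedSpace ℝ E] {v : E → E}
    {w : ℝ → E} {m : ℝ → ℝ} {S : ℝ} (hS : 0 ≤ S) (hm : ContinuousOn m (Icc 0 S))
    (hm0 : ∀ s ∈ Icc 0 S, 0 < m s) (hw : ∀ s ∈ Icc 0 S, HasDerivAt w (m s • v (w s)) s) :
    ∃ T : ℝ, 0 ≤ T ∧ ∃ γ : ℝ → E, γ 0 = w 0 ∧ γ T = w S ∧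
      ∀ τ ∈ Icc 0 T, HasDerivAt γ (v (γ τ)) τ ∧ ∃ s ∈ Icc 0 S, γ τ = w s := by
  obtain ⟨s₀, hs₀, hmin⟩ := isCompact_Icc.exists_isMinOn (nonempty_Icc.2 hS) hm
  set n : ℝ → ℝ := IccExtend hS (domRestrict (Icc 0 S) m)
  have hn : Continuous n := hm.domRestrict.Icc_extend'
  have hnm : ∀ s ∈ Icc 0 S, n s = m s := fun s hs => IccExtend_of_mem _ _ hs
  have hn0 : ∀ s, m s₀ ≤ n s := fun s => hmin (projIcc 0 S hS s).2
  have hs₀' : 0 < m s₀ := hm0 s₀ hs₀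
  set k : ℝ → ℝ := fun s => ∫ τ in (0 : ℝ)..s, n τ
  have hk : ∀ s, HasDerivAt k (n s) s := fun s => (hn.integral_hasStrictDerivAt 0 s).hasDerivAt
  have hkc : Continuous k := continuous_iff_continuousAt.2 fun s => (hk s).continuousAt
  have hk0 : k 0 = 0 := intervalIntegral.integral_same
  have hmono : StrictMono k := strictMono_of_deriv_pos fun s => by
    rw [(hk s).deriv]
    exact hs₀'.trans_le (hn0 s)
  have hlin : Monotone fun s => k s - m s₀ * s := by
    refine monotone_of_deriv_nonneg (fun s => ?_) fun s => ?_
    · exact ((hk s).differentiableAt).sub (by fun_prop)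
    · rw [((hk s).fun_sub ((hasDerivAt_id' s).const_mul (m s₀))).deriv]
      linarith [hn0 s]
  have hsurj : Function.Surjective k := by
    refine hkc.surjective ?_ ?_
    · refine tendsto_atTop_mono' _ ?_ (tendsto_id.const_mul_atTop hs₀')
      filter_upwards [eventually_ge_atTop 0] with s hs
      have := hlin hs
      simp only [hk0, mul_zero, sub_zero] at this
      simpa using this
    · refine tendsto_atBot_mono' _ ?_ (tendsto_id.const_mul_atBot hs₀')
      filter_upwards [eventually_le_atBot 0] with s hs
      have := hlin hs
      simp only [hk0, mul_zero, sub_zero] at this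
      simpa using this
  set e := hmono.orderIsoOfSurjective k hsurj
  have hek : ∀ τ, k (e.symm τ) = τ := fun τ => e.apply_symm_apply τ
  have hke : ∀ s, e.symm (k s) = s := fun s => e.symm_apply_apply s
  have he : ∀ τ, HasDerivAt e.symm (n (e.symm τ))⁻¹ τ := fun τ =>
    HasDerivAt.of_local_left_inverse e.symm.continuous.continuousAt (hk _)
      (hs₀'.trans_le (hn0 _)).ne' (Eventually.of_forall hek)
  refine ⟨k S, hk0 ▸ hmono.monotone hS, fun τ => w (e.symm τ), ?_, ?_, fun τ hτ => ?_⟩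
  · simp only
    rw [← hk0, hke]
    exact congrArg w hk0.symm
  · simp only [hke]
  · have hmem : e.symm τ ∈ Icc 0 S := by
      constructor
      · rw [← hke 0, hk0]; exact e.symm.monotone hτ.1
      · rw [← hke S]; exact e.symm.monotone hτ.2
    refine ⟨?_, _, hmem, rfl⟩
    have := (hw _ hmem).scomp τ (he τ)
    rwa [hnm _ hmem, inv_smul_smul₀ (hm0 _ hmem).ne'] at this

/-- A function analytic near a compact convex set is Lipschitz on that set. -/
theorem AnalyticOnNhd.exists_lipschitzOnWith {E G : Type*} [NormedAddCommGroup E]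
    [NormedSpace ℝ E] [NormedAddCommGroup G] [NormedSpace ℝ G] [CompleteSpace G] {f : E → G}
    {s : Set E} (hf : AnalyticOnNhd ℝ f s) (hs : IsCompact s) (hc : Convex ℝ s) :
    ∃ C, LipschitzOnWith C f s := by
  obtain ⟨C, hC⟩ := hs.exists_bound_of_continuousOn (f := fderiv ℝ f)
    fun x hx => (hf x hx).fderiv.continuousAt.continuousWithinAt
  refine ⟨C.toNNReal, hc.lipschitzOnWith_of_nnnorm_fderiv_le
    (fun x hx => (hf x hx).differentiableAt) fun x hx => ?_⟩
  exact NNReal.le_toNNReal_of_coe_le (hC x hx)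

/-- A function on `[1, ∞)` which is locally the restriction of analytic functions extends to a
function analytic on a neighborhood of `[1, ∞)`. -/
theorem exists_analyticOnNhd_Ici {G : Type*} [NormedAddCommGroup G] [NormedSpace ℝ G]
    {f : ℝ → G} (hf : ∀ t ∈ Ici (1 : ℝ), ∃ g : ℝ → G, AnalyticAt ℝ g t ∧
      ∀ᶠ s in 𝓝 t, 1 ≤ s → f s = g s) :
    ∃ g : ℝ → G, AnalyticOnNhd ℝ g (Ici 1) ∧ EqOn g f (Ici 1) := by
  obtain ⟨g₁, hg₁, hfg⟩ := hf 1 self_mem_Ici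
  refine ⟨fun t => if 1 ≤ t then f t else g₁ t, fun t ht => ?_, fun t ht => if_pos ht⟩
  rcases eq_or_lt_of_le (mem_Ici.1 ht) with rfl | h1
  · refine hg₁.congr ?_
    filter_upwards [hfg] with s hs
    split_ifs with h
    exacts [(hs h).symm, rfl]
  · obtain ⟨g, hg, hev⟩ := hf t ht
    refine hg.congr ?_
    filter_upwards [hev, lt_mem_nhds h1] with s hs h
    rw [if_pos h.le, hs h.le]

theorem HasDerivAt.fst_comp {E G : Type*} [NormedAddCommGroup E] [NormedSpace ℝ E]
    [NormedAddCommGroup G] [NormedSpace ℝ G] {f : ℝ → E × G} {f' : E × G} {s : ℝ}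
    (h : HasDerivAt f f' s) : HasDerivAt (fun s => (f s).1) f'.1 s :=
  (ContinuousLinearMap.fst ℝ E G).hasFDerivAt.comp_hasDerivAt s h

theorem HasDerivAt.snd_comp {E G : Type*} [NormedAddCommGroup E] [NormedSpace ℝ E]
    [NormedAddCommGroup G] [NormedSpace ℝ G] {f : ℝ → E × G} {f' : E × G} {s : ℝ}
    (h : HasDerivAt f f' s) : HasDerivAt (fun s => (f s).2) f'.2 s :=
  (ContinuousLinearMap.snd ℝ E G).hasFDerivAt.comp_hasDerivAt s h

end Auxiliary

section Saddle

theorem isCompact_Bcyl : IsCompact Bcyl := by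
  refine (isCompact_Icc (a := ((0 : ℝ), (0 : ℝ), (0 : ℝ))) (b := (1, 1, 1))).of_isClosed_subset
    ?_ ?_
  · simp only [Bcyl, Set.ofPred_and]
    refine .inter ?_ (.inter ?_ (.inter ?_ (.inter ?_ ?_)))
    all_goals exact isClosed_le (by fun_prop) (by fun_prop)
  · rintro ⟨x, y, z⟩ ⟨h1, h2, h3, h4, h5⟩
    simp only at h1 h2 h3 h4 h5
    refine ⟨⟨h1, h3, h4⟩, ⟨h2, ?_, ?_⟩⟩ <;> simp only <;> nlinarith

theorem convex_Bcyl : Convex ℝ Bcyl := by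
  rintro ⟨x, y, z⟩ ⟨h1, h2, h3, h4, h5⟩ ⟨x', y', z'⟩ ⟨h1', h2', h3', h4', h5'⟩ s t hs ht hst
  simp only at h1 h2 h3 h4 h5 h1' h2' h3' h4' h5'
  refine ⟨?_, ?_, ?_, ?_, ?_⟩ <;> simp only [Prod.fst_add, Prod.snd_add, Prod.smul_fst,
    Prod.smul_snd, smul_eq_mul]
  · positivity
  · nlinarith
  · positivity
  · positivity
  · obtain rfl : s = 1 - t := by linarith
    nlinarith [mul_nonneg (mul_nonneg hs ht) (sq_nonneg (y - y')),
      mul_nonneg (mul_nonneg hs ht) (sq_nonneg (z - z'))]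

/-- The squared distance to the `x`-axis. -/
def axisSq (p : ℝ × ℝ × ℝ) : ℝ := p.2.1 ^ 2 + p.2.2 ^ 2

theorem analyticAt_axisSq (p : ℝ × ℝ × ℝ) : AnalyticAt ℝ axisSq p := by
  have h2 : AnalyticAt ℝ (fun p : ℝ × ℝ × ℝ => p.2.1) p := analyticAt_fst.comp analyticAt_snd
  have h3 : AnalyticAt ℝ (fun p : ℝ × ℝ × ℝ => p.2.2) p := analyticAt_snd.comp analyticAt_snd
  unfold axisSq
  fun_prop

/-- The vector field with eigenvalues `1, -lam, -mu` perturbed by `a, b, c`. -/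
def saddleField (lam mu : ℝ) (a b c : ℝ × ℝ × ℝ → ℝ) (p : ℝ × ℝ × ℝ) : ℝ × ℝ × ℝ :=
  ((1 + a p) * p.1, (-lam + b p) * p.2.1, (-mu + c p) * p.2.2)

/-- Half the rate of decrease of `axisSq` along the saddle field. -/
def contraction (lam mu : ℝ) (b c : ℝ × ℝ × ℝ → ℝ) (p : ℝ × ℝ × ℝ) : ℝ :=
  (lam - b p) * p.2.1 ^ 2 + (mu - c p) * p.2.2 ^ 2

/-- The standing assumptions on the saddle vector field. -/
structure IsSaddle (lam mu : ℝ) (V : Set (ℝ × ℝ × ℝ)) (a b c : ℝ × ℝ × ℝ → ℝ) : Prop where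
  lam_pos : 0 < lam
  mu_pos : 0 < mu
  isOpen : IsOpen V
  subset : Bcyl ⊆ V
  analytic_a : AnalyticOnNhd ℝ a V
  analytic_b : AnalyticOnNhd ℝ b V
  analytic_c : AnalyticOnNhd ℝ c V
  a_zero : a (0, 0, 0) = 0
  b_zero : b (0, 0, 0) = 0
  c_zero : c (0, 0, 0) = 0
  one_add_pos : ∀ p ∈ Bcyl, 0 < 1 + a p
  contraction_pos : ∀ p ∈ Bcyl, 0 < axisSq p → 0 < contraction lam mu b c p

/-- The time the normalized flow needs to go from `φₓ(q)` to the unit cylinder. -/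
noncomputable def exitTime (q : ℝ × ℝ) : ℝ := -Real.log (q.1 ^ 2 + q.2 ^ 2) / 2

theorem exitTime_nonneg {q : ℝ × ℝ} (h1 : q.1 ^ 2 + q.2 ^ 2 ≤ 1) : 0 ≤ exitTime q := by
  have := Real.log_nonpos (by positivity : 0 ≤ q.1 ^ 2 + q.2 ^ 2) h1
  unfold exitTime
  linarith

theorem mul_exp_exitTime {q : ℝ × ℝ} (h : 0 < q.1 ^ 2 + q.2 ^ 2) :
    (q.1 ^ 2 + q.2 ^ 2) * Real.exp (2 * exitTime q) = 1 := by
  have : 2 * exitTime q = -Real.log (q.1 ^ 2 + q.2 ^ 2) := by unfold exitTime; ring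
  rw [this, Real.exp_neg, Real.exp_log h, mul_inv_cancel₀ h.ne']

theorem abs_sub_le_of_hasDerivAt {f Λ f' Λ' : ℝ → ℝ} {C T : ℝ} (hT : 0 ≤ T)
    (hf : ∀ τ ∈ Icc 0 T, HasDerivAt f (f' τ) τ) (hΛ : ∀ τ ∈ Icc 0 T, HasDerivAt Λ (Λ' τ) τ)
    (hC : ∀ τ ∈ Icc 0 T, |f' τ| ≤ C * Λ' τ) : |f T - f 0| ≤ C * (Λ T - Λ 0) := by
  have := image_norm_le_of_norm_deriv_right_le_deriv_boundary' (f := fun τ => f τ - f 0)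
    (f' := f') (a := 0) (b := T) (B := fun τ => C * (Λ τ - Λ 0)) (B' := fun τ => C * Λ' τ)
    (fun τ hτ => ((hf τ hτ).sub_const _).continuousAt.continuousWithinAt)
    (fun τ hτ => ((hf τ ⟨hτ.1, hτ.2.le⟩).sub_const _).hasDerivWithinAt) (by simp)
    (fun τ hτ => (((hΛ τ hτ).sub_const _).const_mul C).continuousAt.continuousWithinAt)
    (fun τ hτ => (((hΛ τ ⟨hτ.1, hτ.2.le⟩).sub_const _).const_mul C).hasDerivWithinAt)
    (fun τ hτ => hC τ ⟨hτ.1, hτ.2.le⟩) ⟨hT, le_rfl⟩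
  simpa using this

theorem axisSq_nonneg (p : ℝ × ℝ × ℝ) : 0 ≤ axisSq p := by unfold axisSq; positivity

theorem zero_mem_Bcyl : ((0 : ℝ), (0 : ℝ), (0 : ℝ)) ∈ Bcyl := by simp [Bcyl]

theorem norm_le_fst_add_sqrt_axisSq {p : ℝ × ℝ × ℝ} (hp : p ∈ Bcyl) :
    ‖p‖ ≤ p.1 + √(axisSq p) := by
  have h1 : p.2.1 ≤ √(axisSq p) := Real.le_sqrt_of_sq_le (by unfold axisSq; nlinarith)
  have h2 : p.2.2 ≤ √(axisSq p) := Real.le_sqrt_of_sq_le (by unfold axisSq; nlinarith)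
  have h3 := Real.sqrt_nonneg (axisSq p)
  have h4 := hp.1
  simp only [Prod.norm_def, Real.norm_eq_abs, abs_of_nonneg hp.1, abs_of_nonneg hp.2.2.1,
    abs_of_nonneg hp.2.2.2.1]
  refine max_le (by linarith) (max_le (by linarith) (by linarith))

theorem AnalyticOnNhd.exists_abs_le_of_zero {f : ℝ × ℝ × ℝ → ℝ}
    (hf : AnalyticOnNhd ℝ f Bcyl) (h0 : f (0, 0, 0) = 0) :
    ∃ K : ℝ, 0 ≤ K ∧ ∀ p ∈ Bcyl, |f p| ≤ K * (p.1 + √(axisSq p)) := by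
  obtain ⟨K, hK⟩ := hf.exists_lipschitzOnWith isCompact_Bcyl convex_Bcyl
  refine ⟨K, K.2, fun p hp => ?_⟩
  have h1 := hK.dist_le_mul p hp _ zero_mem_Bcyl
  rw [h0, dist_zero_right, Real.norm_eq_abs] at h1
  refine h1.trans ?_
  gcongr
  have : dist p ((0 : ℝ), (0 : ℝ), (0 : ℝ)) = ‖p‖ := dist_zero_right p
  rw [this]
  exact norm_le_fst_add_sqrt_axisSq hp

theorem HasDerivAt.eventually_lt_right {f : ℝ → ℝ} {f' τ : ℝ} (h : HasDerivAt f f' τ)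
    (hf' : 0 < f') : ∀ᶠ s in 𝓝[>] τ, f τ < f s := by
  have h1 := (hasDerivAt_iff_tendsto_slope.1 h).eventually (lt_mem_nhds hf')
  filter_upwards [h1.filter_mono (nhdsWithin_mono τ fun s (hs : τ < s) => hs.ne'),
    self_mem_nhdsWithin] with s hs hτ
  rw [slope_def_field] at hs
  have := (div_pos_iff_of_pos_right (sub_pos.2 hτ)).1 hs
  linarith

/-- `p` is the endpoint on the unit cylinder of a backward trajectory starting at `φₓ(q)`. -/
def IsExitPoint (lam mu : ℝ) (a b c : ℝ × ℝ × ℝ → ℝ) (q : ℝ × ℝ) (p : ℝ × ℝ × ℝ) : Prop :=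
  ∃ (T : ℝ) (γ : ℝ → ℝ × ℝ × ℝ), 0 ≤ T ∧ γ 0 = phiX q ∧ γ T = p ∧ axisSq p = 1 ∧
    (∀ τ ∈ Icc 0 T, HasDerivAt γ (-saddleField lam mu a b c (γ τ)) τ) ∧
    ∀ τ ∈ Icc 0 T, γ τ ∈ Bcyl ∧ 0 < (γ τ).1 ∧ 0 < (γ τ).2.1 ∧ 0 < (γ τ).2.2

namespace IsSaddle

variable {lam mu : ℝ} {V : Set (ℝ × ℝ × ℝ)} {a b c : ℝ × ℝ × ℝ → ℝ}

theorem analytic_field (h : IsSaddle lam mu V a b c) :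
    AnalyticOnNhd ℝ (saddleField lam mu a b c) V := fun p hp => by
  have := h.analytic_a p hp
  have := h.analytic_b p hp
  have := h.analytic_c p hp
  have h1 : AnalyticAt ℝ (fun p : ℝ × ℝ × ℝ => p.1) p := analyticAt_fst
  have h2 : AnalyticAt ℝ (fun p : ℝ × ℝ × ℝ => p.2.1) p := analyticAt_fst.comp analyticAt_snd
  have h3 : AnalyticAt ℝ (fun p : ℝ × ℝ × ℝ => p.2.2) p := analyticAt_snd.comp analyticAt_snd
  unfold saddleField
  fun_prop

theorem analytic_contraction (h : IsSaddle lam mu V a b c) :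
    AnalyticOnNhd ℝ (contraction lam mu b c) V := fun p hp => by
  have := h.analytic_b p hp
  have := h.analytic_c p hp
  have h2 : AnalyticAt ℝ (fun p : ℝ × ℝ × ℝ => p.2.1) p := analyticAt_fst.comp analyticAt_snd
  have h3 : AnalyticAt ℝ (fun p : ℝ × ℝ × ℝ => p.2.2) p := analyticAt_snd.comp analyticAt_snd
  unfold contraction
  fun_prop

theorem exists_normalized_flow (h : IsSaddle lam mu V a b c) {δ : ℝ} (hδ : 0 < δ) :
    ∃ (F : ℝ × ℝ × ℝ → ℝ × ℝ × ℝ) (Fl : ℝ → ℝ × ℝ × ℝ → ℝ × ℝ × ℝ) (K : ℝ≥0),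
      LipschitzWith K F ∧ IsGlobalFlow F Fl ∧
      (∀ p ∈ Bcyl, δ ≤ axisSq p → AnalyticAt ℝ F p ∧
        F p = -(axisSq p / contraction lam mu b c p) • saddleField lam mu a b c p) ∧
      ∀ q : ℝ × ℝ, 0 < q.1 → 0 < q.2 → δ ≤ q.1 ^ 2 + q.2 ^ 2 → q.1 ^ 2 + q.2 ^ 2 ≤ 1 →
        (∀ s ∈ Icc 0 (exitTime q), Fl s (phiX q) ∈ Bcyl ∧ δ ≤ axisSq (Fl s (phiX q)) ∧
          0 < (Fl s (phiX q)).1 ∧ 0 < (Fl s (phiX q)).2.1 ∧ 0 < (Fl s (phiX q)).2.2) ∧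
        axisSq (Fl (exitTime q) (phiX q)) = 1 := by
  set Q := contraction lam mu b c with hQ
  set U : Set (ℝ × ℝ × ℝ) := V ∩ (fun p => (axisSq p, Q p, 1 + a p)) ⁻¹'
    (Ioi 0 ×ˢ Ioi 0 ×ˢ Ioi 0) with hU
  have hUo : IsOpen U := by
    refine ContinuousOn.isOpen_inter_preimage ?_ h.isOpen
      (isOpen_Ioi.prod (isOpen_Ioi.prod isOpen_Ioi))
    refine ContinuousOn.prodMk ?_ (ContinuousOn.prodMk ?_ ?_)
    · exact fun p _ => (analyticAt_axisSq p).continuousAt.continuousWithinAt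
    · exact h.analytic_contraction.continuousOn
    · exact continuousOn_const.add h.analytic_a.continuousOn
  set Kc : Set (ℝ × ℝ × ℝ) := Bcyl ∩ {p | δ ≤ axisSq p} with hKc
  have hKcc : IsCompact Kc := isCompact_Bcyl.inter_right
    (isClosed_le continuous_const (by unfold axisSq; fun_prop))
  have hKU : Kc ⊆ U := fun p hp =>
    ⟨h.subset hp.1, hδ.trans_le hp.2, h.contraction_pos p hp.1 (hδ.trans_le hp.2),
      h.one_add_pos p hp.1⟩
  obtain ⟨χ, hχs, hχ01, hχ1, hχc, hχU⟩ := exists_smooth_cutoff hUo hKcc hKU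
  have hRQ : AnalyticOnNhd ℝ (fun p => -(axisSq p / Q p)) U := fun p hp =>
    ((analyticAt_axisSq p).div (h.analytic_contraction p hp.1) (ne_of_gt hp.2.2.1)).neg
  set η : ℝ × ℝ × ℝ → ℝ × ℝ × ℝ := fun p =>
    -(axisSq p / Q p) • saddleField lam mu a b c p with hη
  have hηa : AnalyticOnNhd ℝ η U := fun p hp =>
    (hRQ p hp).smul (h.analytic_field p hp.1)
  have cut : ∀ {G : Type} [NormedAddCommGroup G] [NormedSpace ℝ G] [CompleteSpace G]
      {g : ℝ × ℝ × ℝ → G}, AnalyticOnNhd ℝ g U → ContDiff ℝ ∞ fun x => χ x • g x :=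
    fun hg => ContDiffOn.cutoff_smul hUo hχs hχU fun p hp => (hg p hp).contDiffAt.contDiffWithinAt
  set F : ℝ × ℝ × ℝ → ℝ × ℝ × ℝ := fun p => χ p • η p with hF
  have hFs : ContDiff ℝ ∞ F := cut hηa
  have hFc : HasCompactSupport F := hχc.smul_right
  obtain ⟨K, hK⟩ := hFs.lipschitzWith_of_hasCompactSupport hFc (by simp)
  obtain ⟨L, hL⟩ := hFs.continuous.bounded_above_of_compact_support hFc
  obtain ⟨Fl, hFl⟩ := exists_isGlobalFlow (L := L.toNNReal) hK
    fun x => (hL x).trans (Real.le_coe_toNNReal L)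
  refine ⟨F, Fl, K, hK, hFl, fun p hp hpδ => ?_, fun q hq1 hq2 hqδ hq => ?_⟩
  · have hev := hχ1 p ⟨hp, hpδ⟩
    refine ⟨(hηa p (hKU ⟨hp, hpδ⟩)).congr ?_, ?_⟩
    · filter_upwards [hev] with y hy
      simp [hF, hy]
    · simp [hF, hη, hev.self_of_nhds]
  set w : ℝ → ℝ × ℝ × ℝ := fun s => Fl s (phiX q) with hw
  have hwd : ∀ s, HasDerivAt w (F (w s)) s := hFl.hasDerivAt _
  have hwc : Continuous w := continuous_iff_continuousAt.2 fun s => (hwd s).continuousAt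
  have hw0 : w 0 = (1, q.1, q.2) := hFl.map_zero _
  have hx : ∀ s, HasDerivAt (fun s => (w s).1)
      ((χ (w s) • (-(axisSq (w s) / Q (w s)) * (1 + a (w s)))) * (w s).1) s := fun s => by
    refine (hwd s).fst_comp.congr_deriv ?_
    simp only [hF, hη, saddleField, Prod.smul_fst, smul_eq_mul]
    ring
  have hy : ∀ s, HasDerivAt (fun s => (w s).2.1)
      ((χ (w s) • (-(axisSq (w s) / Q (w s)) * (-lam + b (w s)))) * (w s).2.1) s := fun s => by
    refine (hwd s).snd_comp.fst_comp.congr_deriv ?_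
    simp only [hF, hη, saddleField, Prod.smul_fst, Prod.smul_snd, smul_eq_mul]
    ring
  have hz : ∀ s, HasDerivAt (fun s => (w s).2.2)
      ((χ (w s) • (-(axisSq (w s) / Q (w s)) * (-mu + c (w s)))) * (w s).2.2) s := fun s => by
    refine (hwd s).snd_comp.snd_comp.congr_deriv ?_
    simp only [hF, hη, saddleField, Prod.smul_snd, smul_eq_mul]
    ring
  have hxp : ∀ s, 0 < (w s).1 := pos_of_hasDerivAt_mul
    ((cut fun p hp => (hRQ p hp).mul (analyticAt_const.add (h.analytic_a p hp.1))).continuous.comp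
      hwc) hx (by simp [hw0])
  have hyp : ∀ s, 0 < (w s).2.1 := pos_of_hasDerivAt_mul
    ((cut fun p hp => (hRQ p hp).mul (analyticAt_const.add (h.analytic_b p hp.1))).continuous.comp
      hwc) hy (by simp [hw0, hq1])
  have hzp : ∀ s, 0 < (w s).2.2 := pos_of_hasDerivAt_mul
    ((cut fun p hp => (hRQ p hp).mul (analyticAt_const.add (h.analytic_c p hp.1))).continuous.comp
      hwc) hz (by simp [hw0, hq2])
  have hχU' : ∀ p, p ∉ U → χ p = 0 := fun p hp =>
    image_eq_zero_of_notMem_tsupport fun h => hp (hχU h)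
  have hxanti : Antitone fun s => (w s).1 := antitone_of_deriv_nonpos
    (fun s => (hx s).differentiableAt) fun s => by
      rw [(hx s).deriv]
      by_cases hs : w s ∈ U
      · have h1 : 0 < axisSq (w s) / Q (w s) := div_pos hs.2.1 hs.2.2.1
        have h2 : 0 < 1 + a (w s) := hs.2.2.2
        have h3 := mul_nonneg (mul_nonneg (hχ01 (w s)).1 (mul_pos h1 h2).le) (hxp s).le
        rw [smul_eq_mul]
        linarith
      · simp [hχU' _ hs]
  have hR : ∀ s, HasDerivAt (fun s => axisSq (w s)) (2 * χ (w s) * axisSq (w s)) s := fun s => by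
    refine (((hy s).fun_pow 2).fun_add ((hz s).fun_pow 2)).congr_deriv ?_
    by_cases hs : w s ∈ U
    · have hQ0 : Q (w s) ≠ 0 := ne_of_gt hs.2.2.1
      have : axisSq (w s) = axisSq (w s) / Q (w s) *
        ((lam - b (w s)) * (w s).2.1 ^ 2 + (mu - c (w s)) * (w s).2.2 ^ 2) :=
        (div_mul_cancel₀ _ hQ0).symm
      conv_rhs => rw [this]
      simp only [smul_eq_mul]
      push_cast
      ring
    · simp [hχU' _ hs]
  have hR0 : axisSq (w 0) = q.1 ^ 2 + q.2 ^ 2 := by rw [hw0]; rfl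
  have hRmono : Monotone fun s => axisSq (w s) := monotone_of_deriv_nonneg
    (fun s => (hR s).differentiableAt) fun s => by
      rw [(hR s).deriv]
      have h1 := (hχ01 (w s)).1
      have h2 : 0 ≤ axisSq (w s) := by unfold axisSq; positivity
      positivity
  have hE : ∀ s : ℝ, HasDerivAt (fun s => Real.exp (-(2 * s))) (Real.exp (-(2 * s)) * -2) s :=
    fun s => by
      have := ((hasDerivAt_id' s).const_mul 2).fun_neg.exp
      simpa using this
  have hRd : ∀ s, HasDerivAt (fun s => axisSq (w s) * Real.exp (-(2 * s)))
      (2 * (χ (w s) - 1) * (axisSq (w s) * Real.exp (-(2 * s)))) s := fun s => by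
    refine ((hR s).fun_mul (hE s)).congr_deriv ?_
    ring
  have hRanti : Antitone fun s => axisSq (w s) * Real.exp (-(2 * s)) := antitone_of_deriv_nonpos
    (fun s => (hRd s).differentiableAt) fun s => by
      rw [(hRd s).deriv]
      have h1 := (hχ01 (w s)).2
      have h2 : 0 ≤ axisSq (w s) * Real.exp (-(2 * s)) := by unfold axisSq; positivity
      nlinarith
  have hexit := mul_exp_exitTime (hδ.trans_le hqδ)
  have hin : ∀ s ∈ Icc 0 (exitTime q), w s ∈ Bcyl ∧ δ ≤ axisSq (w s) := fun s hs => by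
    refine ⟨⟨(hxp s).le, ?_, (hyp s).le, (hzp s).le, ?_⟩, ?_⟩
    · simpa [hw0] using hxanti hs.1
    · have h1 := hRanti hs.1
      simp only [mul_zero, neg_zero, Real.exp_zero, mul_one, hR0] at h1
      have h2 : axisSq (w s) ≤ (q.1 ^ 2 + q.2 ^ 2) * Real.exp (2 * s) := by
        rw [Real.exp_neg, ← div_eq_mul_inv, div_le_iff₀ (Real.exp_pos _)] at h1
        exact h1
      refine h2.trans (hexit ▸ ?_)
      gcongr
      exact hs.2
    · exact hqδ.trans (hR0 ▸ hRmono hs.1)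
  refine ⟨fun s hs => ⟨(hin s hs).1, (hin s hs).2, hxp s, hyp s, hzp s⟩, ?_⟩
  have hT := exitTime_nonneg hq
  have hconst := constant_of_has_deriv_right_zero
    (f := fun s => axisSq (w s) * Real.exp (-(2 * s))) (a := 0) (b := exitTime q)
    (fun s _ => (hRd s).continuousAt.continuousWithinAt) (fun s hs => by
      have h1 := (hχ1 (w s) (hin s ⟨hs.1, hs.2.le⟩)).self_of_nhds
      have := (hRd s).hasDerivWithinAt (s := Ici s)
      rwa [h1, sub_self, mul_zero, zero_mul] at this) (exitTime q) ⟨hT, le_rfl⟩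
  simp only [mul_zero, neg_zero, Real.exp_zero, mul_one, hR0] at hconst
  rw [← hexit, ← hconst, mul_assoc, ← Real.exp_add, neg_add_cancel, Real.exp_zero, mul_one]

/-- Near the face `x = 0`, the contraction rate towards the axis is uniform. -/
theorem exists_contraction_rate (h : IsSaddle lam mu V a b c) :
    ∃ δ κ : ℝ, 0 < δ ∧ 0 < κ ∧
      ∀ p ∈ Bcyl, p.1 ≤ δ → κ * axisSq p ≤ contraction lam mu b c p := by
  have h0V := h.subset zero_mem_Bcyl
  have hb : ∀ᶠ p in 𝓝 ((0 : ℝ), (0 : ℝ), (0 : ℝ)), b p < lam / 2 :=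
    (h.analytic_b _ h0V).continuousAt.eventually_lt_const (by rw [h.b_zero]; linarith [h.lam_pos])
  have hc : ∀ᶠ p in 𝓝 ((0 : ℝ), (0 : ℝ), (0 : ℝ)), c p < mu / 2 :=
    (h.analytic_c _ h0V).continuousAt.eventually_lt_const (by rw [h.c_zero]; linarith [h.mu_pos])
  obtain ⟨ε, hε, hball⟩ := Metric.eventually_nhds_iff_ball.1 (hb.and hc)
  have hfar : ∃ κ : ℝ, 0 < κ ∧ ∀ p ∈ Bcyl, ε ^ 2 ≤ axisSq p → κ ≤ contraction lam mu b c p := by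
    have hcpt : IsCompact (Bcyl ∩ {p | ε ^ 2 ≤ axisSq p}) := isCompact_Bcyl.inter_right
      (isClosed_le continuous_const (by unfold axisSq; fun_prop))
    rcases (Bcyl ∩ {p | ε ^ 2 ≤ axisSq p}).eq_empty_or_nonempty with he | hne
    · exact ⟨1, one_pos, fun p hp hp' => absurd (show p ∈ Bcyl ∩ {p | ε ^ 2 ≤ axisSq p} from
        ⟨hp, hp'⟩) (by simp [he])⟩
    · obtain ⟨p₀, hp₀, hmin⟩ := hcpt.exists_isMinOn hne
        (h.analytic_contraction.continuousOn.mono (inter_subset_left.trans h.subset))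
      exact ⟨_, h.contraction_pos p₀ hp₀.1 (lt_of_lt_of_le (by positivity) hp₀.2),
        fun p hp hp' => hmin ⟨hp, hp'⟩⟩
  obtain ⟨κ, hκ, hκle⟩ := hfar
  have hl := h.lam_pos
  have hm := h.mu_pos
  refine ⟨ε / 2, min κ (min (lam / 2) (mu / 2)), by positivity, by positivity, fun p hp hpδ => ?_⟩
  by_cases hR : ε ^ 2 ≤ axisSq p
  · calc _ ≤ κ * axisSq p := by gcongr; exacts [axisSq_nonneg p, min_le_left _ _]
      _ ≤ κ := mul_le_of_le_one_right hκ.le hp.2.2.2.2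
      _ ≤ _ := hκle p hp hR
  · have hy : p.2.1 < ε := by unfold axisSq at hR; nlinarith [sq_nonneg p.2.2]
    have hz : p.2.2 < ε := by unfold axisSq at hR; nlinarith [sq_nonneg p.2.1]
    have hpb : p ∈ Metric.ball ((0 : ℝ), (0 : ℝ), (0 : ℝ)) ε := by
      simp only [Metric.mem_ball, Prod.dist_eq, Real.dist_eq, sub_zero, max_lt_iff,
        abs_of_nonneg hp.1, abs_of_nonneg hp.2.2.1, abs_of_nonneg hp.2.2.2.1]
      exact ⟨by linarith, hy, hz⟩
    obtain ⟨h1, h2⟩ := hball p hpb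
    set k := min κ (min (lam / 2) (mu / 2))
    have hk1 : k ≤ lam / 2 := (min_le_right _ _).trans (min_le_left _ _)
    have hk2 : k ≤ mu / 2 := (min_le_right _ _).trans (min_le_right _ _)
    unfold axisSq contraction
    rw [mul_add]
    gcongr <;> linarith

/-- A linear combination of `x` and the distance to the axis serves as a Lyapunov function. -/
theorem exists_lyapunov (h : IsSaddle lam mu V a b c) :
    ∃ k A : ℝ, 0 < k ∧ 0 ≤ A ∧ ∀ p ∈ Bcyl, 0 < axisSq p →
      k * (p.1 + √(axisSq p)) ≤
        A * ((1 + a p) * p.1) + contraction lam mu b c p / √(axisSq p) := by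
  obtain ⟨δ, κ, hδ, hκ, hrate⟩ := h.exists_contraction_rate
  obtain ⟨p₀, hp₀, hmin⟩ := isCompact_Bcyl.exists_isMinOn ⟨_, zero_mem_Bcyl⟩
    (f := fun p => 1 + a p) (continuousOn_const.add (h.analytic_a.continuousOn.mono h.subset))
  have hm := h.one_add_pos p₀ hp₀
  set m := 1 + a p₀
  refine ⟨κ, κ * (1 + 1 / δ) / m, hκ, by positivity, fun p hp hR => ?_⟩
  set r := √(axisSq p)
  have hr : 0 < r := Real.sqrt_pos.2 hR
  have hr1 : r ≤ 1 := Real.sqrt_le_one.2 hp.2.2.2.2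
  have hrr : r * r = axisSq p := Real.mul_self_sqrt hR.le
  have hQ := h.contraction_pos p hp hR
  have hx : κ * (1 + 1 / δ) * p.1 ≤ κ * (1 + 1 / δ) / m * ((1 + a p) * p.1) := by
    have : m * p.1 ≤ (1 + a p) * p.1 := mul_le_mul_of_nonneg_right (hmin hp) hp.1
    calc κ * (1 + 1 / δ) * p.1 = κ * (1 + 1 / δ) / m * (m * p.1) := by field_simp
      _ ≤ _ := by gcongr
  refine le_trans ?_ (add_le_add_left hx _)
  by_cases hpδ : p.1 ≤ δ
  · have h1 : κ * r ≤ contraction lam mu b c p / r := by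
      rw [le_div_iff₀ hr, mul_assoc, hrr]
      exact hrate p hp hpδ
    have h2 : 0 ≤ κ * (1 / δ) * p.1 := mul_nonneg (by positivity) hp.1
    linarith
  · have h1 : 0 ≤ contraction lam mu b c p / r := by positivity
    have h2 : 1 ≤ 1 / δ * p.1 := by
      rw [one_div, inv_mul_eq_div, one_le_div hδ]
      exact (not_le.1 hpδ).le
    have h3 : κ * r ≤ κ * (1 / δ * p.1) := by gcongr; linarith
    linarith

/-- Along backward trajectories in the cylinder starting on the plane `x = 1`, the logarithms of
the coordinates agree with those of the linear flow up to a uniformly bounded error. -/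
theorem exists_log_estimate (h : IsSaddle lam mu V a b c) :
    ∃ M : ℝ, ∀ (γ : ℝ → ℝ × ℝ × ℝ) (T : ℝ) (q : ℝ × ℝ), 0 ≤ T → γ 0 = phiX q →
      (∀ τ ∈ Icc 0 T, HasDerivAt γ (-saddleField lam mu a b c (γ τ)) τ) →
      (∀ τ ∈ Icc 0 T, γ τ ∈ Bcyl ∧ 0 < (γ τ).1 ∧ 0 < (γ τ).2.1 ∧ 0 < (γ τ).2.2) →
      |Real.log (γ T).1 + T| ≤ M ∧ |Real.log (γ T).2.1 - Real.log q.1 - lam * T| ≤ M ∧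
        |Real.log (γ T).2.2 - Real.log q.2 - mu * T| ≤ M := by
  obtain ⟨k, A, hk, hA, hlyap⟩ := h.exists_lyapunov
  obtain ⟨Ka, hKa, hKa'⟩ := (h.analytic_a.mono h.subset).exists_abs_le_of_zero h.a_zero
  obtain ⟨Kb, hKb, hKb'⟩ := (h.analytic_b.mono h.subset).exists_abs_le_of_zero h.b_zero
  obtain ⟨Kc, hKc, hKc'⟩ := (h.analytic_c.mono h.subset).exists_abs_le_of_zero h.c_zero
  set C := (Ka + Kb + Kc) / k
  have hC : 0 ≤ C := by positivity
  refine ⟨C * (A + 1), fun γ T q hT h0 hγ hB => ?_⟩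
  have hRpos : ∀ τ ∈ Icc 0 T, 0 < axisSq (γ τ) := fun τ hτ => by
    have := (hB τ hτ).2.2.1
    unfold axisSq
    positivity
  set Λ : ℝ → ℝ := fun τ => -A * (γ τ).1 + √(axisSq (γ τ))
  set Λ' : ℝ → ℝ := fun τ => A * ((1 + a (γ τ)) * (γ τ).1) +
    contraction lam mu b c (γ τ) / √(axisSq (γ τ))
  have hx : ∀ τ ∈ Icc 0 T, HasDerivAt (fun τ => (γ τ).1) (-((1 + a (γ τ)) * (γ τ).1)) τ :=
    fun τ hτ => (hγ τ hτ).fst_comp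
  have hy : ∀ τ ∈ Icc 0 T, HasDerivAt (fun τ => (γ τ).2.1) (-((-lam + b (γ τ)) * (γ τ).2.1)) τ :=
    fun τ hτ => (hγ τ hτ).snd_comp.fst_comp
  have hz : ∀ τ ∈ Icc 0 T, HasDerivAt (fun τ => (γ τ).2.2) (-((-mu + c (γ τ)) * (γ τ).2.2)) τ :=
    fun τ hτ => (hγ τ hτ).snd_comp.snd_comp
  have hR : ∀ τ ∈ Icc 0 T, HasDerivAt (fun τ => axisSq (γ τ))
      (2 * contraction lam mu b c (γ τ)) τ := fun τ hτ => by
    refine (((hy τ hτ).fun_pow 2).fun_add ((hz τ hτ).fun_pow 2)).congr_deriv ?_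
    unfold contraction
    push_cast
    ring
  have hΛ : ∀ τ ∈ Icc 0 T, HasDerivAt Λ (Λ' τ) τ := fun τ hτ => by
    refine (((hx τ hτ).const_mul (-A)).fun_add ((hR τ hτ).sqrt (hRpos τ hτ).ne')).congr_deriv ?_
    simp only [Λ']
    have : √(axisSq (γ τ)) ≠ 0 := (Real.sqrt_pos.2 (hRpos τ hτ)).ne'
    field_simp
  have hΛle : ∀ τ ∈ Icc 0 T, ∀ v K : ℝ, |v| ≤ K * ((γ τ).1 + √(axisSq (γ τ))) →
      K ≤ Ka + Kb + Kc → |-v| ≤ C * Λ' τ := fun τ hτ v K hv hK => by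
    have h1 := (hB τ hτ).2.1
    have h2 := Real.sqrt_nonneg (axisSq (γ τ))
    calc |-v| = |v| := abs_neg v
      _ ≤ K * ((γ τ).1 + √(axisSq (γ τ))) := hv
      _ ≤ (Ka + Kb + Kc) * ((γ τ).1 + √(axisSq (γ τ))) := by gcongr
      _ = C * (k * ((γ τ).1 + √(axisSq (γ τ)))) := by simp only [C]; field_simp
      _ ≤ C * Λ' τ := by gcongr; exact hlyap _ (hB τ hτ).1 (hRpos τ hτ)
  have hΛT : C * (Λ T - Λ 0) ≤ C * (A + 1) := by
    have h1 : √(axisSq (γ T)) ≤ 1 := Real.sqrt_le_one.2 (hB T ⟨hT, le_rfl⟩).1.2.2.2.2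
    have h2 : 0 ≤ A * (γ T).1 := mul_nonneg hA (hB T ⟨hT, le_rfl⟩).2.1.le
    have h3 := Real.sqrt_nonneg (axisSq (γ 0))
    have h4 : (γ 0).1 = 1 := by rw [h0]; rfl
    gcongr
    simp only [Λ, h4]
    linarith
  have hL : ∀ {w : ℝ → ℝ} {τ r : ℝ}, HasDerivAt w (-(r * w τ)) τ → 0 < w τ →
      HasDerivAt (fun τ => Real.log (w τ)) (-r) τ := fun hw hpos => by
    refine (hw.log hpos.ne').congr_deriv ?_
    field_simp
  have e1 := abs_sub_le_of_hasDerivAt hT (f := fun τ => Real.log (γ τ).1 + τ)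
    (f' := fun τ => -a (γ τ)) (fun τ hτ => by
      refine ((hL (hx τ hτ) (hB τ hτ).2.1).fun_add (hasDerivAt_id' τ)).congr_deriv ?_
      ring) hΛ fun τ hτ => hΛle τ hτ _ _ (hKa' _ (hB τ hτ).1) (by linarith)
  have e2 := abs_sub_le_of_hasDerivAt hT (f := fun τ => Real.log (γ τ).2.1 - lam * τ)
    (f' := fun τ => -b (γ τ)) (fun τ hτ => by
      refine ((hL (hy τ hτ) (hB τ hτ).2.2.1).fun_sub
        ((hasDerivAt_id' τ).const_mul lam)).congr_deriv ?_
      ring) hΛ fun τ hτ => hΛle τ hτ _ _ (hKb' _ (hB τ hτ).1) (by linarith)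
  have e3 := abs_sub_le_of_hasDerivAt hT (f := fun τ => Real.log (γ τ).2.2 - mu * τ)
    (f' := fun τ => -c (γ τ)) (fun τ hτ => by
      refine ((hL (hz τ hτ) (hB τ hτ).2.2.2).fun_sub
        ((hasDerivAt_id' τ).const_mul mu)).congr_deriv ?_
      ring) hΛ fun τ hτ => hΛle τ hτ _ _ (hKc' _ (hB τ hτ).1) (by linarith)
  simp only [h0, phiX, Real.log_one, add_zero, sub_zero, mul_zero] at e1 e2 e3
  refine ⟨e1.trans hΛT, ?_, ?_⟩
  · rw [sub_right_comm]
    exact e2.trans hΛT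
  · rw [sub_right_comm]
    exact e3.trans hΛT

/-- A backward trajectory in the cylinder stops as soon as it reaches the lateral boundary. -/
theorem eq_of_axisSq_eq_one (h : IsSaddle lam mu V a b c) {γ : ℝ → ℝ × ℝ × ℝ} {T τ : ℝ}
    (hγ : ∀ τ ∈ Icc 0 T, HasDerivAt γ (-saddleField lam mu a b c (γ τ)) τ)
    (hB : ∀ τ ∈ Icc 0 T, γ τ ∈ Bcyl) (hτ : τ ∈ Icc 0 T) (h1 : axisSq (γ τ) = 1) : τ = T := by
  by_contra hne
  have hlt : τ < T := lt_of_le_of_ne hτ.2 hne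
  have hR : HasDerivAt (fun τ => axisSq (γ τ)) (2 * contraction lam mu b c (γ τ)) τ := by
    refine (((hγ τ hτ).snd_comp.fst_comp.fun_pow 2).fun_add
      ((hγ τ hτ).snd_comp.snd_comp.fun_pow 2)).congr_deriv ?_
    simp only [contraction, saddleField, Prod.snd_neg, Prod.fst_neg]
    push_cast
    ring
  have hpos := h.contraction_pos _ (hB τ hτ) (by rw [h1]; exact one_pos)
  obtain ⟨s, hs1, hs2⟩ := ((hR.eventually_lt_right (by positivity)).and
    (Ioo_mem_nhdsGT hlt)).exists
  rw [h1] at hs1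
  exact absurd (hB s ⟨hτ.1.trans hs2.1.le, hs2.2.le⟩).2.2.2.2 (not_le.2 hs1)

theorem eqOn_backward (h : IsSaddle lam mu V a b c) {γ₁ γ₂ : ℝ → ℝ × ℝ × ℝ} {T : ℝ}
    (hγ₁ : ∀ τ ∈ Icc 0 T, HasDerivAt γ₁ (-saddleField lam mu a b c (γ₁ τ)) τ)
    (hγ₂ : ∀ τ ∈ Icc 0 T, HasDerivAt γ₂ (-saddleField lam mu a b c (γ₂ τ)) τ)
    (hB₁ : ∀ τ ∈ Icc 0 T, γ₁ τ ∈ Bcyl) (hB₂ : ∀ τ ∈ Icc 0 T, γ₂ τ ∈ Bcyl)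
    (h0 : γ₁ 0 = γ₂ 0) : EqOn γ₁ γ₂ (Icc 0 T) := by
  obtain ⟨K, hK⟩ := (h.analytic_field.mono h.subset).exists_lipschitzOnWith isCompact_Bcyl
    convex_Bcyl
  exact ODE_solution_unique_of_mem_Icc_right (v := fun _ p => -saddleField lam mu a b c p)
    (s := fun _ => Bcyl) (fun _ _ => hK.neg)
    (fun τ hτ => (hγ₁ τ hτ).continuousAt.continuousWithinAt)
    (fun τ hτ => (hγ₁ τ ⟨hτ.1, hτ.2.le⟩).hasDerivWithinAt) (fun τ hτ => hB₁ τ ⟨hτ.1, hτ.2.le⟩)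
    (fun τ hτ => (hγ₂ τ hτ).continuousAt.continuousWithinAt)
    (fun τ hτ => (hγ₂ τ ⟨hτ.1, hτ.2.le⟩).hasDerivWithinAt) (fun τ hτ => hB₂ τ ⟨hτ.1, hτ.2.le⟩) h0

theorem exit_unique (h : IsSaddle lam mu V a b c) {γ₁ γ₂ : ℝ → ℝ × ℝ × ℝ} {T₁ T₂ : ℝ}
    (hT₁ : 0 ≤ T₁) (hT₂ : 0 ≤ T₂)
    (hγ₁ : ∀ τ ∈ Icc 0 T₁, HasDerivAt γ₁ (-saddleField lam mu a b c (γ₁ τ)) τ)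
    (hγ₂ : ∀ τ ∈ Icc 0 T₂, HasDerivAt γ₂ (-saddleField lam mu a b c (γ₂ τ)) τ)
    (hB₁ : ∀ τ ∈ Icc 0 T₁, γ₁ τ ∈ Bcyl) (hB₂ : ∀ τ ∈ Icc 0 T₂, γ₂ τ ∈ Bcyl)
    (h0 : γ₁ 0 = γ₂ 0) (h₁ : axisSq (γ₁ T₁) = 1) (h₂ : axisSq (γ₂ T₂) = 1) :
    γ₁ T₁ = γ₂ T₂ := by
  wlog hle : T₁ ≤ T₂ generalizing γ₁ γ₂ T₁ T₂
  · exact (this hT₂ hT₁ hγ₂ hγ₁ hB₂ hB₁ h0.symm h₂ h₁ (not_le.1 hle).le).symm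
  have hsub : Icc 0 T₁ ⊆ Icc 0 T₂ := Icc_subset_Icc_right hle
  have heq := h.eqOn_backward hγ₁ (fun τ hτ => hγ₂ τ (hsub hτ)) hB₁ (fun τ hτ => hB₂ τ (hsub hτ))
    h0 ⟨hT₁, le_rfl⟩
  rw [heq] at h₁ ⊢
  rw [h.eq_of_axisSq_eq_one hγ₂ hB₂ ⟨hT₁, hle⟩ h₁]

theorem exitPoint_unique (h : IsSaddle lam mu V a b c) {q : ℝ × ℝ} {p p' : ℝ × ℝ × ℝ}
    (hp : IsExitPoint lam mu a b c q p) (hp' : IsExitPoint lam mu a b c q p') : p = p' := by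
  obtain ⟨T, γ, hT, h0, rfl, h1, hγ, hB⟩ := hp
  obtain ⟨T', γ', hT', h0', rfl, h1', hγ', hB'⟩ := hp'
  exact h.exit_unique hT hT' hγ hγ' (fun τ hτ => (hB τ hτ).1) (fun τ hτ => (hB' τ hτ).1)
    (h0.trans h0'.symm) h1 h1'

/-- The exit points are given by the normalized flow. -/
theorem isExitPoint_flow (h : IsSaddle lam mu V a b c) {δ : ℝ} (hδ : 0 < δ)
    {F : ℝ × ℝ × ℝ → ℝ × ℝ × ℝ} {Fl : ℝ → ℝ × ℝ × ℝ → ℝ × ℝ × ℝ} (hFl : IsGlobalFlow F Fl)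
    (hF : ∀ p ∈ Bcyl, δ ≤ axisSq p →
      F p = -(axisSq p / contraction lam mu b c p) • saddleField lam mu a b c p)
    {q : ℝ × ℝ} {S : ℝ} (hS : 0 ≤ S)
    (hB : ∀ s ∈ Icc 0 S, Fl s (phiX q) ∈ Bcyl ∧ δ ≤ axisSq (Fl s (phiX q)) ∧
      0 < (Fl s (phiX q)).1 ∧ 0 < (Fl s (phiX q)).2.1 ∧ 0 < (Fl s (phiX q)).2.2)
    (h1 : axisSq (Fl S (phiX q)) = 1) :
    IsExitPoint lam mu a b c q (Fl S (phiX q)) := by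
  have hpos : ∀ s ∈ Icc 0 S, 0 < contraction lam mu b c (Fl s (phiX q)) := fun s hs =>
    h.contraction_pos _ (hB s hs).1 (hδ.trans_le (hB s hs).2.1)
  obtain ⟨T, hT, γ, h0, hγT, hγ⟩ := exists_reparam
    (v := fun p => -saddleField lam mu a b c p) (w := fun s => Fl s (phiX q))
    (m := fun s => axisSq (Fl s (phiX q)) / contraction lam mu b c (Fl s (phiX q))) hS
    (fun s hs => by
      have hc : ContinuousAt (fun s => Fl s (phiX q)) s := (hFl.hasDerivAt _ s).continuousAt
      have h1 : ContinuousAt (fun s => axisSq (Fl s (phiX q))) s :=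
        (analyticAt_axisSq _).continuousAt.comp hc
      have h2 : ContinuousAt (fun s => contraction lam mu b c (Fl s (phiX q))) s :=
        ContinuousAt.comp (g := contraction lam mu b c)
          (h.analytic_contraction _ (h.subset (hB s hs).1)).continuousAt hc
      exact (h1.div h2 (hpos s hs).ne').continuousWithinAt)
    (fun s hs => div_pos (hδ.trans_le (hB s hs).2.1) (hpos s hs))
    (fun s hs => by
      have := hFl.hasDerivAt (phiX q) s
      rwa [hF _ (hB s hs).1 (hB s hs).2.1, neg_smul, ← smul_neg] at this)
  refine ⟨T, γ, hT, h0.trans (hFl.map_zero _), hγT, h1, fun τ hτ => (hγ τ hτ).1, fun τ hτ => ?_⟩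
  obtain ⟨s, hs, hsτ⟩ := (hγ τ hτ).2
  rw [hsτ]
  exact ⟨(hB s hs).1, (hB s hs).2.2⟩

theorem exists_isExitPoint (h : IsSaddle lam mu V a b c) {q : ℝ × ℝ} (hq1 : 0 < q.1)
    (hq2 : 0 < q.2) (hq : q.1 ^ 2 + q.2 ^ 2 ≤ 1) : ∃ p, IsExitPoint lam mu a b c q p := by
  have hδ : 0 < q.1 ^ 2 + q.2 ^ 2 := by positivity
  obtain ⟨F, Fl, K, -, hFl, hF, hq'⟩ := h.exists_normalized_flow hδ
  obtain ⟨hB, h1⟩ := hq' q hq1 hq2 le_rfl hq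
  exact ⟨_, h.isExitPoint_flow hδ hFl (fun p hp hp' => (hF p hp hp').2) (exitTime_nonneg hq) hB h1⟩

/-- The points of the saturation on the unit cylinder are the exit points. -/
theorem mem_saturation_iff (h : IsSaddle lam mu V a b c) {C' : Set (ℝ × ℝ)}
    (hC' : C' ⊆ {q : ℝ × ℝ | 0 < q.1 ∧ 0 < q.2 ∧ q.1 ^ 2 + q.2 ^ 2 ≤ 1}) {p : ℝ × ℝ × ℝ}
    (hp : axisSq p = 1) :
    p ∈ Saturation (saddleField lam mu a b c) (phiX '' C') ↔
      ∃ q ∈ C', IsExitPoint lam mu a b c q p := by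
  constructor
  · rintro ⟨s₀, s₁, hs, γ, hB, hγ, ⟨s, hsm, rfl⟩, hA⟩
    have hA' : ∃ q ∈ C', phiX q = γ s₁ := by
      rcases hA with ⟨q, hq, hqγ⟩ | hA
      · rcases eq_or_lt_of_le hs with rfl | hlt
        · exact ⟨q, hq, hqγ⟩
        · have hm : s₀ ∈ Icc s₀ s₁ := ⟨le_rfl, hs⟩
          have hx1 : (γ s₀).1 = 1 := by rw [← hqγ]; rfl
          have hpos := h.one_add_pos _ (hB s₀ hm)
          obtain ⟨σ, hσ1, hσ2⟩ := (((hγ s₀ hm).fst_comp.eventually_lt_right (by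
            simpa [saddleField, hx1] using hpos)).and (Ioo_mem_nhdsGT hlt)).exists
          rw [hx1] at hσ1
          exact absurd (hB σ ⟨hσ2.1.le, hσ2.2.le⟩).2.1 (not_le.2 hσ1)
      · exact hA
    obtain ⟨q, hq, hqγ⟩ := hA'
    refine ⟨q, hq, ?_⟩
    obtain ⟨hq1, hq2, hq3⟩ := hC' hq
    obtain ⟨p, hpq⟩ := h.exists_isExitPoint hq1 hq2 hq3
    suffices γ s = p by rwa [this]
    obtain ⟨T, δ, hT, h0, rfl, h1, hδ, hδB⟩ := hpq
    have hmem : ∀ τ ∈ Icc 0 (s₁ - s), s₁ - τ ∈ Icc s₀ s₁ := fun τ hτ =>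
      ⟨by linarith [hτ.2, hsm.1], by linarith [hτ.1]⟩
    have hγ' : ∀ τ ∈ Icc 0 (s₁ - s), HasDerivAt (fun τ => γ (s₁ - τ))
        (-saddleField lam mu a b c (γ (s₁ - τ))) τ := fun τ hτ =>
      (hγ _ (hmem τ hτ)).comp_const_sub s₁ τ
    have := h.exit_unique (γ₁ := fun τ => γ (s₁ - τ)) (sub_nonneg.2 hsm.2) hT hγ' hδ
      (fun τ hτ => hB _ (hmem τ hτ)) (fun τ hτ => (hδB τ hτ).1)
      (by simp only [sub_zero]; rw [h0, hqγ]) (by simpa using hp) h1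
    simpa using this
  · rintro ⟨q, hq, T, γ, hT, h0, rfl, h1, hγ, hB⟩
    have hmem : ∀ τ ∈ Icc (-T) 0, 0 - τ ∈ Icc 0 T := fun τ hτ =>
      ⟨by linarith [hτ.2], by linarith [hτ.1]⟩
    refine ⟨-T, 0, by linarith, fun τ => γ (0 - τ), fun τ hτ => (hB _ (hmem τ hτ)).1,
      fun τ hτ => ?_, ⟨-T, ⟨le_rfl, by linarith⟩, by simp⟩, Or.inr ⟨q, hq, by simp [h0]⟩⟩
    simpa only [neg_neg] using (hγ _ (hmem τ hτ)).comp_const_sub 0 τ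

/-- The exit point depends analytically on an analytic curve of starting points, and its velocity
vanishes only if that of the starting point does. -/
theorem exists_analyticAt_exitPoint (h : IsSaddle lam mu V a b c) {p : ℝ → ℝ × ℝ} {t₀ : ℝ}
    (hp : AnalyticAt ℝ p t₀) (h1 : 0 < (p t₀).1) (h2 : 0 < (p t₀).2)
    (h3 : (p t₀).1 ^ 2 + (p t₀).2 ^ 2 ≤ 1) :
    ∃ g : ℝ → ℝ × ℝ × ℝ, AnalyticAt ℝ g t₀ ∧
      (∀ᶠ t in 𝓝 t₀, 0 < (p t).1 → 0 < (p t).2 → (p t).1 ^ 2 + (p t).2 ^ 2 ≤ 1 →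
        IsExitPoint lam mu a b c (p t) (g t)) ∧
      (deriv g t₀ = 0 → deriv p t₀ = 0) := by
  set N : ℝ → ℝ := fun t => (p t).1 ^ 2 + (p t).2 ^ 2
  have hN0 : 0 < N t₀ := by positivity
  have hp1 : AnalyticAt ℝ (fun t => (p t).1) t₀ := analyticAt_fst.comp hp
  have hp2 : AnalyticAt ℝ (fun t => (p t).2) t₀ := analyticAt_snd.comp hp
  have hNa : AnalyticAt ℝ N t₀ := (hp1.pow 2).add (hp2.pow 2)
  have hδ : 0 < N t₀ / 2 := by positivity
  obtain ⟨F, Fl, K, hK, hFl, hF, hflow⟩ := h.exists_normalized_flow hδ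
  set S : ℝ → ℝ := fun t => exitTime (p t) with hS
  set φ : ℝ → ℝ × ℝ × ℝ := fun t => phiX (p t) with hφ
  have hSa : AnalyticAt ℝ S t₀ := ((hNa.log hN0).neg).div analyticAt_const two_ne_zero
  have hφa : AnalyticAt ℝ φ t₀ := analyticAt_const.prod (hp1.prod hp2)
  have hSt : 0 ≤ S t₀ := exitTime_nonneg h3
  obtain ⟨hB, hR1⟩ := hflow (p t₀) h1 h2 (by linarith) h3
  have hFla : AnalyticAt ℝ (fun q : ℝ × ℝ × ℝ × ℝ => Fl q.1 q.2) (S t₀, φ t₀) :=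
    hFl.analyticAt_uncurry hK fun s hs => by
      rw [uIcc_of_le hSt] at hs
      exact (hF _ (hB s hs).1 (hB s hs).2.1).1
  set g : ℝ → ℝ × ℝ × ℝ := fun t => Fl (S t) (φ t) with hg
  have hga : AnalyticAt ℝ g t₀ := AnalyticAt.fun_comp (f := fun t => (S t, φ t)) hFla
    (hSa.prod hφa)
  refine ⟨g, hga, ?_, fun hg0 => ?_⟩
  · filter_upwards [hNa.continuousAt.eventually_const_lt (half_lt_self hN0)] with t ht ht1 ht2 ht3
    obtain ⟨hB, hR1⟩ := hflow (p t) ht1 ht2 ht.le ht3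
    exact h.isExitPoint_flow hδ hFl (fun p hp hp' => (hF p hp hp').2) (exitTime_nonneg ht3) hB hR1
  · have hback : ∀ t, Fl (-S t) (g t) = φ t := fun t => by
      rw [hg, ← hFl.map_add hK, neg_add_cancel, hFl.map_zero]
    have hFlb : AnalyticAt ℝ (fun q : ℝ × ℝ × ℝ × ℝ => Fl q.1 q.2) (-S t₀, g t₀) :=
      hFl.analyticAt_uncurry hK fun s hs => by
        rw [uIcc_of_ge (neg_nonpos.2 hSt)] at hs
        have hs' : s + S t₀ ∈ Icc 0 (exitTime (p t₀)) :=
          ⟨by linarith [hs.1], by change s + S t₀ ≤ S t₀; linarith [hs.2]⟩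
        rw [hg, ← hFl.map_add hK]
        exact (hF _ (hB _ hs').1 (hB _ hs').2.1).1
    set A := fderiv ℝ (fun q : ℝ × ℝ × ℝ × ℝ => Fl q.1 q.2) (-S t₀, g t₀)
    have hA : HasFDerivAt (fun q : ℝ × ℝ × ℝ × ℝ => Fl q.1 q.2) A (-S t₀, g t₀) :=
      hFlb.differentiableAt.hasFDerivAt
    have hA1 : A (1, 0) = F (φ t₀) := by
      have e0 : HasDerivAt (fun s : ℝ => (s, g t₀)) (1, 0) (-S t₀) :=
        (hasDerivAt_id' _).prodMk (hasDerivAt_const _ _)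
      have e1 : HasDerivAt (fun s => Fl s (g t₀)) (A (1, 0)) (-S t₀) :=
        hA.comp_hasDerivAt (l := fun q : ℝ × ℝ × ℝ × ℝ => Fl q.1 q.2) (-S t₀) e0
      have e2 := hFl.hasDerivAt (g t₀) (-S t₀)
      rw [hback] at e2
      exact e1.unique e2
    have hSd := hSa.differentiableAt.hasDerivAt
    have hgd := hga.differentiableAt.hasDerivAt
    rw [hg0] at hgd
    have hφd : HasDerivAt φ (-deriv S t₀ • F (φ t₀)) t₀ := by
      have e1 := hA.comp_hasDerivAt t₀ (hSd.neg.prodMk hgd)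
      have e2 : (-deriv S t₀, (0 : ℝ × ℝ × ℝ)) = -deriv S t₀ • ((1 : ℝ), (0 : ℝ × ℝ × ℝ)) := by
        simp
      rw [e2, map_smul, hA1] at e1
      exact e1.congr_of_eventuallyEq (Eventually.of_forall fun t => (hback t).symm)
    have hx : (-deriv S t₀ • F (φ t₀)).1 = 0 := hφd.fst_comp.unique (hasDerivAt_const t₀ (1 : ℝ))
    have h0 := hB 0 ⟨le_rfl, hSt⟩
    rw [hFl.map_zero] at h0
    have hR0 : 0 < axisSq (phiX (p t₀)) := hδ.trans_le h0.2.1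
    have hQ0 := h.contraction_pos _ h0.1 hR0
    have ha0 := h.one_add_pos _ h0.1
    have hS0 : deriv S t₀ = 0 := by
      rw [hφ, (hF _ h0.1 h0.2.1).2] at hx
      simp only [Prod.smul_fst, smul_eq_mul, saddleField] at hx
      have hne : axisSq (phiX (p t₀)) / contraction lam mu b c (phiX (p t₀)) ≠ 0 :=
        (div_pos hR0 hQ0).ne'
      simpa [hne, ha0.ne', h0.2.2.1.ne'] using hx
    rw [hS0, neg_zero, zero_smul] at hφd
    exact (hφd.snd_comp).deriv

end IsSaddle

end Saddle

section Asymptotics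

theorem Real.mul_le_two_div_pi_mul_arcsin {z : ℝ} (h0 : 0 ≤ z) (h1 : z ≤ 1) :
    z / 2 ≤ 2 / Real.pi * Real.arcsin z ∧ 2 / Real.pi * Real.arcsin z ≤ z := by
  have ha := Real.arcsin_nonneg.2 h0
  have hs : Real.sin (Real.arcsin z) = z := Real.sin_arcsin (by linarith) h1
  refine ⟨?_, by simpa [hs] using Real.mul_le_sin ha (Real.arcsin_le_pi_div_two z)⟩
  have h2 := Real.sin_le ha
  rw [hs] at h2
  have h3 : 1 / 2 ≤ 2 / Real.pi := by
    rw [div_le_div_iff₀ two_pos Real.pi_pos]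
    linarith [Real.pi_le_four]
  calc z / 2 = 1 / 2 * z := by ring
    _ ≤ _ := by gcongr

/-- Asymptotics of the transition map of a saddle which is logarithmically close to linear. -/
theorem saddle_transition_asymptotics {lam mu ρ M k₁ k₂ : ℝ} (hlam : 0 < lam) (hmu : 0 < mu)
    (hρ : mu / lam < ρ) {u v T x y z : ℝ → ℝ}
    (hpos : ∀ᶠ t in atTop, (0 < u t ∧ 0 < v t) ∧ 0 < x t ∧ 0 < y t ∧ 0 < z t)
    (hyz : ∀ᶠ t in atTop, y t ^ 2 + z t ^ 2 = 1)
    (hX : ∀ᶠ t in atTop, |Real.log (x t) + T t| ≤ M)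
    (hY : ∀ᶠ t in atTop, |Real.log (y t) - Real.log (u t) - lam * T t| ≤ M)
    (hZ : ∀ᶠ t in atTop, |Real.log (z t) - Real.log (v t) - mu * T t| ≤ M)
    (hu : Tendsto u atTop (𝓝 0)) (hv : Tendsto v atTop (𝓝 0)) (hk₁ : 0 < k₁)
    (hw : ∀ᶠ t in atTop, k₁ * u t ^ ρ < v t ∧ v t < k₂ * u t ^ ρ) :
    Tendsto x atTop (𝓝 0) ∧ Tendsto z atTop (𝓝 0) ∧ ∃ C : ℝ, ∀ᶠ t in atTop,
      |Real.log (x t) - Real.log (2 / Real.pi * Real.arcsin (z t)) / (lam * ρ - mu)| ≤ C := by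
  have hρ0 : 0 < ρ := (div_pos hmu hlam).trans hρ
  have hσ : 0 < lam * ρ - mu := by
    rw [div_lt_iff₀ hlam] at hρ
    linarith
  set σ := lam * ρ - mu with hσdef
  set L := Real.log 2
  have hlog_half : ∀ {w : ℝ}, 1 / 2 ≤ w → -L ≤ Real.log w := fun {w} hw => by
    have := Real.log_le_log (by norm_num) hw
    rwa [one_div, Real.log_inv] at this
  have tlog : ∀ {w : ℝ → ℝ}, (∀ᶠ t in atTop, 0 < w t) → Tendsto w atTop (𝓝 0) →
      Tendsto (fun t => Real.log (w t)) atTop atBot := fun hw0 hw =>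
    Real.tendsto_log_nhdsGT_zero.comp (tendsto_nhdsWithin_iff.2 ⟨hw, hw0⟩)
  have hlu := tlog (hpos.mono fun _ h => h.1.1) hu
  have hlv := tlog (hpos.mono fun _ h => h.1.2) hv
  have hT : Tendsto T atTop atTop := by
    refine tendsto_atTop.2 fun N => ?_
    filter_upwards [hpos, hyz, hY, hZ, hlu.eventually (eventually_le_atBot (-(lam * N) - M - L)),
      hlv.eventually (eventually_le_atBot (-(mu * N) - M - L))] with t hp h1 hY hZ hu hv
    obtain ⟨-, -, hy, hz⟩ := hp
    rw [abs_le] at hY hZ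
    by_cases hy2 : 1 / 2 ≤ y t
    · have := hlog_half hy2
      exact le_of_mul_le_mul_left (by linarith) hlam
    · have := hlog_half (w := z t) (by nlinarith)
      exact le_of_mul_le_mul_left (by linarith) hmu
  set D := max |Real.log k₁| |Real.log k₂|
  have hD : ∀ᶠ t in atTop, |Real.log (v t) - ρ * Real.log (u t)| ≤ D := by
    filter_upwards [hpos, hw] with t hp hw
    have hpow := Real.rpow_pos_of_pos hp.1.1 ρ
    have hk₂ : 0 < k₂ := (pos_iff_pos_of_mul_pos (hp.1.2.trans hw.2)).2 hpow
    have h1 := Real.log_le_log (mul_pos hk₁ hpow) hw.1.le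
    have h2 := Real.log_le_log hp.1.2 hw.2.le
    rw [Real.log_mul hk₁.ne' hpow.ne', Real.log_rpow hp.1.1] at h1
    rw [Real.log_mul hk₂.ne' hpow.ne', Real.log_rpow hp.1.1] at h2
    have h3 : |Real.log k₁| ≤ D := le_max_left _ _
    have h4 : |Real.log k₂| ≤ D := le_max_right _ _
    have h5 := neg_abs_le (Real.log k₁)
    have h6 := le_abs_self (Real.log k₂)
    rw [abs_le]
    constructor <;> linarith
  have hZle : ∀ᶠ t in atTop, Real.log (z t) ≤ -(σ * T t) + (ρ * M + D + M) := by
    filter_upwards [hpos, hyz, hY, hZ, hD] with t hp h1 hY hZ hD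
    have hy : Real.log (y t) ≤ 0 := Real.log_nonpos hp.2.2.1.le (by nlinarith [sq_nonneg (z t)])
    rw [abs_le] at hY hZ hD
    have h2 : ρ * Real.log (u t) ≤ ρ * (-(lam * T t) + M) := by gcongr; linarith
    rw [hσdef]
    linarith
  have hσT : Tendsto (fun t => σ * T t) atTop atTop := hT.const_mul_atTop hσ
  have hZbot : Tendsto (fun t => Real.log (z t)) atTop atBot :=
    tendsto_atBot_mono' _ hZle
      (tendsto_atBot_add_const_right _ _ (tendsto_neg_atTop_atBot.comp hσT))
  have hXbot : Tendsto (fun t => Real.log (x t)) atTop atBot := by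
    refine tendsto_atBot_mono' _ ?_ (tendsto_atBot_add_const_right _ M
      (tendsto_neg_atTop_atBot.comp hT))
    filter_upwards [hX] with t hX
    rw [abs_le] at hX
    simp only [Function.comp]
    linarith
  refine ⟨?_, ?_, (M + (ρ * (M + L) + D + M) / σ) + L / σ, ?_⟩
  · exact (Real.tendsto_exp_atBot.comp hXbot).congr' (hpos.mono fun t h => Real.exp_log h.2.1)
  · exact (Real.tendsto_exp_atBot.comp hZbot).congr' (hpos.mono fun t h => Real.exp_log h.2.2.2)
  · filter_upwards [hpos, hyz, hX, hY, hZ, hD, hZle,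
      hZbot.eventually (eventually_le_atBot (-L))] with t hp h1 hX hY hZ hD hZle hZL
    obtain ⟨-, hx, hy, hz⟩ := hp
    have hz2 : z t ≤ 1 / 2 := by
      have := Real.exp_le_exp.2 hZL
      rwa [Real.exp_log hz, Real.exp_neg, Real.exp_log two_pos, ← one_div] at this
    have hy2 := hlog_half (w := y t) (by nlinarith)
    have hL : 0 < L := Real.log_pos one_lt_two
    rw [abs_le] at hX hY hZ hD
    have h2 : ρ * (-(lam * T t) - M - L) ≤ ρ * Real.log (u t) := by gcongr; linarith
    have hZge : -(ρ * (M + L) + D + M) ≤ Real.log (z t) + σ * T t := by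
      rw [hσdef]
      linarith
    have hZle' : Real.log (z t) + σ * T t ≤ ρ * (M + L) + D + M := by
      have := mul_pos hρ0 hL
      linarith
    obtain ⟨hd1, hd2⟩ := Real.mul_le_two_div_pi_mul_arcsin hz.le (by linarith)
    have hl1 := Real.log_le_log (by positivity) hd1
    have hl2 := Real.log_le_log (lt_of_lt_of_le (by positivity) hd1) hd2
    rw [Real.log_div hz.ne' two_ne_zero] at hl1
    set l := Real.log (2 / Real.pi * Real.arcsin (z t))
    have e : Real.log (x t) - l / σ = (Real.log (x t) + T t) -
      (Real.log (z t) + σ * T t) / σ + (Real.log (z t) - l) / σ := by field_simp; ring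
    have e1 : |(Real.log (z t) + σ * T t) / σ| ≤ (ρ * (M + L) + D + M) / σ := by
      rw [abs_div, abs_of_pos hσ]
      gcongr
      exact abs_le.2 ⟨hZge, hZle'⟩
    have e2 : |(Real.log (z t) - l) / σ| ≤ L / σ := by
      rw [abs_div, abs_of_pos hσ]
      gcongr
      exact abs_le.2 ⟨by linarith, by linarith⟩
    rw [e]
    exact (abs_add_le _ _).trans (add_le_add ((abs_sub _ _).trans (add_le_add (abs_le.2 hX) e1)) e2)

end Asymptotics

theorem fencePhi_mem_axis (q : ℝ × ℝ) : axisSq (fencePhi q) = 1 := Real.cos_sq_add_sin_sq _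

/-- The points of the fence in `ℝ²_{>0}`, in terms of their fence coordinates. -/
theorem eq_fencePhi {p : ℝ × ℝ × ℝ} (hy : 0 ≤ p.2.1) (hp : axisSq p = 1) :
    fencePhi (2 / Real.pi * Real.arcsin p.2.2, p.1) = p := by
  have hz : p.2.2 ^ 2 ≤ 1 := by unfold axisSq at hp; nlinarith [sq_nonneg p.2.1]
  have hz' := abs_le.1 ((sq_le_one_iff_abs_le_one _).1 hz)
  have e : Real.pi * (2 / Real.pi * Real.arcsin p.2.2) / 2 = Real.arcsin p.2.2 := by
    field_simp [Real.pi_ne_zero]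
  simp only [fencePhi, e, Real.sin_arcsin hz'.1 hz'.2, Real.cos_arcsin]
  have : 1 - p.2.2 ^ 2 = p.2.1 ^ 2 := by rw [← hp]; unfold axisSq; ring
  rw [this, Real.sqrt_sq hy]

theorem fencePhi_inj {q : ℝ × ℝ} (hq : q ∈ fenceSquare) :
    (2 / Real.pi * Real.arcsin (fencePhi q).2.2, (fencePhi q).1) = q := by
  have h0 := hq.1.1
  have h1 := hq.1.2
  have hpi := Real.pi_pos
  have e : Real.arcsin (Real.sin (Real.pi * q.1 / 2)) = Real.pi * q.1 / 2 :=
    Real.arcsin_sin (by nlinarith) (by nlinarith)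
  ext
  · simp only [fencePhi, e]
    field_simp
  · rfl

theorem differentiable_fencePhi : Differentiable ℝ fencePhi := by
  unfold fencePhi
  fun_prop

theorem IsSaddle.hasWeight {lam mu : ℝ} {V : Set (ℝ × ℝ × ℝ)} {a b c : ℝ × ℝ × ℝ → ℝ}
    (h : IsSaddle lam mu V a b c) {C' : Set (ℝ × ℝ)}
    (hC' : C' ⊆ {q : ℝ × ℝ | 0 < q.1 ∧ 0 < q.2 ∧ q.1 ^ 2 + q.2 ^ 2 ≤ 1})
    {ρ : ℝ} (hρ : mu / lam < ρ) (hw : SetHasWeight C' ρ) :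
    (fenceSquare ∩ fencePhi ⁻¹' Saturation (saddleField lam mu a b c) (phiX '' C')) ⊆
        {q : ℝ × ℝ | 0 < q.1 ∧ 0 < q.2} ∧
      SetHasWeight (fenceSquare ∩ fencePhi ⁻¹' Saturation (saddleField lam mu a b c) (phiX '' C'))
        (1 / (lam * ρ - mu)) := by
  obtain ⟨p, ⟨hpa, hpp, hpd, hp0⟩, ⟨k₁, k₂, t₁, hk₁, -, ht₁, hk⟩, rfl⟩ := hw
  have hpC : ∀ t ∈ Ici (1 : ℝ), 0 < (p t).1 ∧ 0 < (p t).2 ∧ (p t).1 ^ 2 + (p t).2 ^ 2 ≤ 1 :=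
    fun t ht => hC' (mem_image_of_mem p ht)
  have hex : ∀ t ∈ Ici (1 : ℝ), ∃ P, IsExitPoint lam mu a b c (p t) P := fun t ht =>
    h.exists_isExitPoint (hpC t ht).1 (hpC t ht).2.1 (hpC t ht).2.2
  choose! P hP using hex
  have hPB : ∀ t ∈ Ici (1 : ℝ), P t ∈ Bcyl ∧ 0 < (P t).1 ∧ 0 < (P t).2.1 ∧ 0 < (P t).2.2 ∧
      axisSq (P t) = 1 := fun t ht => by
    obtain ⟨T, γ, hT, -, hγT, h1, -, hB⟩ := hP t ht
    have := hB T ⟨hT, le_rfl⟩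
    rw [hγT] at this
    exact ⟨this.1, this.2.1, this.2.2.1, this.2.2.2, h1⟩
  have hz1 : ∀ t ∈ Ici (1 : ℝ), (P t).2.2 < 1 := fun t ht => by
    obtain ⟨-, -, hy, hz, h1⟩ := hPB t ht
    unfold axisSq at h1
    nlinarith [pow_pos hy 2]
  set d : ℝ → ℝ × ℝ := fun t => (2 / Real.pi * Real.arcsin (P t).2.2, (P t).1)
  have hΦd : ∀ t ∈ Ici (1 : ℝ), fencePhi (d t) = P t := fun t ht =>
    eq_fencePhi (hPB t ht).2.2.1.le (hPB t ht).2.2.2.2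
  have hdpos : ∀ t ∈ Ici (1 : ℝ), 0 < (d t).1 ∧ 0 < (d t).2 := fun t ht => by
    obtain ⟨-, hx, -, hz, -⟩ := hPB t ht
    exact ⟨mul_pos (by positivity) (Real.arcsin_pos.2 hz), hx⟩
  have hset : fenceSquare ∩ fencePhi ⁻¹' Saturation (saddleField lam mu a b c)
      (phiX '' (p '' Ici 1)) = d '' Ici 1 := by
    ext q
    constructor
    · rintro ⟨hq, hqS⟩
      obtain ⟨-, ⟨t, ht, rfl⟩, hqt⟩ := (h.mem_saturation_iff hC' (fencePhi_mem_axis q)).1 hqS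
      refine ⟨t, ht, ?_⟩
      simp only [d, h.exitPoint_unique (hP t ht) hqt]
      exact fencePhi_inj hq
    · rintro ⟨t, ht, rfl⟩
      obtain ⟨hB, -, -, hz, h1⟩ := hPB t ht
      refine ⟨⟨⟨(hdpos t ht).1.le, ?_⟩, ⟨(hdpos t ht).2.le, hB.2.1⟩⟩, ?_⟩
      · exact (Real.mul_le_two_div_pi_mul_arcsin hz.le (hz1 t ht).le).2.trans (hz1 t ht).le
      · rw [mem_preimage, hΦd t ht]
        exact (h.mem_saturation_iff hC' h1).2 ⟨_, mem_image_of_mem p ht, hP t ht⟩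
  have hloc : ∀ t ∈ Ici (1 : ℝ), ∃ g : ℝ → ℝ × ℝ × ℝ, AnalyticAt ℝ g t ∧
      (∀ᶠ s in 𝓝 t, 1 ≤ s → P s = g s) ∧ (deriv g t = 0 → deriv p t = 0) := fun t ht => by
    obtain ⟨hp1, hp2, hp3⟩ := hpC t ht
    obtain ⟨g, hg, hev, hd⟩ := h.exists_analyticAt_exitPoint (hpa t ht) hp1 hp2 hp3
    refine ⟨g, hg, ?_, hd⟩
    filter_upwards [hev] with s hs hs1
    exact h.exitPoint_unique (hP s hs1) (hs (hpC s hs1).1 (hpC s hs1).2.1 (hpC s hs1).2.2)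
  obtain ⟨D, hDa, hDd⟩ := exists_analyticOnNhd_Ici (f := d) fun t ht => by
    obtain ⟨g, hg, hev, -⟩ := hloc t ht
    have hgt : g t = P t := (hev.self_of_nhds ht).symm
    refine ⟨fun s => (2 / Real.pi * Real.arcsin (g s).2.2, (g s).1), ?_, ?_⟩
    · have hg1 : AnalyticAt ℝ (fun s => (g s).1) t := analyticAt_fst.comp hg
      have hg3 : AnalyticAt ℝ (fun s => (g s).2.2) t :=
        analyticAt_snd.comp (analyticAt_snd.comp hg)
      have hz := (hPB t ht).2.2.2.1
      have hz' := hz1 t ht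
      have harc : AnalyticAt ℝ Real.arcsin (g t).2.2 := by
        rw [hgt]
        exact (Real.contDiffAt_arcsin (by linarith) (by linarith)).analyticAt
      exact (analyticAt_const.mul (AnalyticAt.fun_comp (g := Real.arcsin)
        (f := fun s => (g s).2.2) harc hg3)).prod hg1
    · filter_upwards [hev] with s hs hs1
      simp only [d, hs hs1]
  have hDset : d '' Ici 1 = D '' Ici 1 := image_congr fun t ht => (hDd ht).symm
  have hderiv : ∀ t : ℝ, 1 < t → deriv D t ≠ 0 := fun t ht hD0 => by
    obtain ⟨g, hg, hev, hd⟩ := hloc t ht.le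
    refine hpd t ht (hd ?_)
    have hDt := (hDa t ht.le).differentiableAt.hasDerivAt
    rw [hD0] at hDt
    have hcomp := (differentiable_fencePhi (D t)).hasFDerivAt.comp_hasDerivAt t hDt
    rw [map_zero] at hcomp
    refine (hcomp.congr_of_eventuallyEq ?_).deriv
    filter_upwards [hev, lt_mem_nhds ht] with s hs hs1
    rw [← hs hs1.le, ← hΦd s hs1.le, ← hDd hs1.le]
    rfl
  obtain ⟨M, hM⟩ := h.exists_log_estimate
  have hest : ∀ t ∈ Ici (1 : ℝ), ∃ T : ℝ, |Real.log (P t).1 + T| ≤ M ∧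
      |Real.log (P t).2.1 - Real.log (p t).1 - lam * T| ≤ M ∧
      |Real.log (P t).2.2 - Real.log (p t).2 - mu * T| ≤ M := fun t ht => by
    obtain ⟨T, γ, hT, h0, hγT, -, hγ, hB⟩ := hP t ht
    exact ⟨T, hγT ▸ hM γ T (p t) hT h0 hγ hB⟩
  choose! T hT using hest
  have h1ev : ∀ᶠ t : ℝ in atTop, t ∈ Ici (1 : ℝ) := eventually_ge_atTop 1
  obtain ⟨hx0, hz0, C, hC⟩ := saddle_transition_asymptotics (T := T) (M := M) h.lam_pos h.mu_pos hρ
    (h1ev.mono fun t ht => ⟨hpp t ht, (hPB t ht).2.1, (hPB t ht).2.2.1, (hPB t ht).2.2.2.1⟩)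
    (h1ev.mono fun t ht => (hPB t ht).2.2.2.2) (h1ev.mono fun t ht => (hT t ht).1)
    (h1ev.mono fun t ht => (hT t ht).2.1) (h1ev.mono fun t ht => (hT t ht).2.2)
    ((continuous_fst.tendsto _).comp hp0) ((continuous_snd.tendsto _).comp hp0) hk₁
    ((eventually_gt_atTop t₁).mono hk)
  rw [hset]
  refine ⟨?_, hDset ▸ ⟨D, ⟨hDa, fun t ht => hDd ht ▸ hdpos t ht, hderiv, ?_⟩, ?_, rfl⟩⟩
  · rintro _ ⟨t, ht, rfl⟩
    exact hdpos t ht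
  · have hd1 : Tendsto (fun t => 2 / Real.pi * Real.arcsin (P t).2.2) atTop (𝓝 0) := by
      have := ((Real.continuous_arcsin.tendsto 0).comp hz0).const_mul (2 / Real.pi)
      simpa using this
    exact (hd1.prodMk_nhds hx0).congr' (h1ev.mono fun t ht => (hDd ht).symm)
  · obtain ⟨t₂, ht₂⟩ := eventually_atTop.1 (h1ev.and hC)
    refine ⟨Real.exp (-(|C| + 1)), Real.exp (|C| + 1), max t₂ 2, Real.exp_pos _,
      Real.exp_lt_exp.2 (by linarith [abs_nonneg C]), lt_max_of_lt_right one_lt_two,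
      fun t ht => ?_⟩
    obtain ⟨ht1, htC⟩ := ht₂ t ((le_max_left _ _).trans ht.le)
    rw [hDd ht1]
    obtain ⟨hd1, hd2⟩ := hdpos t ht1
    have hlt := htC.trans (le_abs_self C)
    change |Real.log (d t).2 - Real.log (d t).1 / (lam * ρ - mu)| ≤ |C| at hlt
    rw [abs_le] at hlt
    rw [Real.rpow_def_of_pos hd1, ← Real.exp_add, ← Real.exp_add, mul_one_div,
      ← Real.lt_log_iff_exp_lt hd2, ← Real.log_lt_iff_lt_exp hd2]
    constructor <;> linarith

/-- weight transition through a three-dimensional saddle, first case: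
if `C'` has weight `ρ' > μ/λ` and `S'` is the saturation of `φₓ(C')` by the
`ξ`-flow in `B`, then `Φ⁻¹(S')` lies in the open quadrant and has weight
`1/(λρ' − μ)`. -/
theorem weight_transition_first_case
    (lam mu : ℝ) (hlam : 0 < lam) (hmu : 0 < mu)
    (V : Set (ℝ × ℝ × ℝ)) (hVopen : IsOpen V) (hBV : Bcyl ⊆ V)
    (a b c : ℝ × ℝ × ℝ → ℝ)
    (ha : AnalyticOnNhd ℝ a V) (hb : AnalyticOnNhd ℝ b V) (hc : AnalyticOnNhd ℝ c V)
    (ha0 : a (0, 0, 0) = 0) (hb0 : b (0, 0, 0) = 0) (hc0 : c (0, 0, 0) = 0)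
    (ξ : ℝ × ℝ × ℝ → ℝ × ℝ × ℝ)
    (hξ : ∀ p : ℝ × ℝ × ℝ,
      ξ p = ((1 + a p) * p.1, (-lam + b p) * p.2.1, (-mu + c p) * p.2.2))
    (htrans1 : ∀ p ∈ Bcyl, 0 < 1 + a p)
    (htrans2 : ∀ p ∈ Bcyl, (p.2.1, p.2.2) ≠ ((0 : ℝ), (0 : ℝ)) →
      (-lam + b p) * p.2.1 ^ 2 + (-mu + c p) * p.2.2 ^ 2 < 0)
    (C' : Set (ℝ × ℝ))
    (hC' : C' ⊆ {q : ℝ × ℝ | 0 < q.1 ∧ 0 < q.2 ∧ q.1 ^ 2 + q.2 ^ 2 ≤ 1})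
    (ρ' : ℝ) (hρ' : mu / lam < ρ') (hw : SetHasWeight C' ρ')
    (S' : Set (ℝ × ℝ × ℝ)) (hS' : S' = Saturation ξ (phiX '' C')) :
    (fenceSquare ∩ fencePhi ⁻¹' S') ⊆ {q : ℝ × ℝ | 0 < q.1 ∧ 0 < q.2} ∧
      SetHasWeight (fenceSquare ∩ fencePhi ⁻¹' S') (1 / (lam * ρ' - mu)) := by
  obtain rfl : ξ = saddleField lam mu a b c := funext hξ
  subst hS'
  have h : IsSaddle lam mu V a b c :=
    ⟨hlam, hmu, hVopen, hBV, ha, hb, hc, ha0, hb0, hc0, htrans1, fun p hp hR => by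
      have := htrans2 p hp fun heq => by
        simp only [Prod.mk.injEq] at heq
        simp [axisSq, heq.1, heq.2] at hR
      unfold contraction
      linarith⟩
  exact h.hasWeight hC' hρ' hw
end
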